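/- arXiv:2303.08491 — 4 statements merged into one kernel-verified Lean document; each statement's English description precedes it below -/
import Mathlib

section
/- There is a family (B_X), indexed by the subsets X of ℝ (a set of cardinality 𝔠), of Boolean subalgebras of P(ω)/fin such that for all X, Y ⊆ ℝ: (i) if X ⊆ Y then B_Y is a subalgebra of B_X, and (ii) if X ⊄ Y then there is no Boolean algebra embedding of B_Y into B_X. -/
open Filter

/-- `P(ω)/fin`: the quotient of the Boolean algebra of all subsets of `ℕ`
(viewed as functions `ℕ → Prop`, i.e. `Set ℕ`) by the equivalence
`A ~ B` iff the symmetric difference of `A` and `B` is finite, i.e. iff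
`A` and `B` agree on a cofinite set of coordinates. -/
abbrev PowModFin : Type := Filter.Germ (Filter.cofinite : Filter ℕ) Prop

instance : ComplementedLattice PowModFin := by
  constructor
  intro a
  induction a using Filter.Germ.inductionOn with
  | _ f =>
    refine ⟨(↑(fun n => (f n)ᶜ) : PowModFin), IsCompl.of_eq ?_ ?_⟩
    · show (↑(fun n => f n ⊓ (f n)ᶜ) : PowModFin) = ⊥
      have : (fun n => f n ⊓ (f n)ᶜ) = fun _ : ℕ => (⊥ : Prop) := by
        funext n; simp
      rw [this]; rfl
    · show (↑(fun n => f n ⊔ (f n)ᶜ) : PowModFin) = ⊤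
      have : (fun n => f n ⊔ (f n)ᶜ) = fun _ : ℕ => (⊤ : Prop) := by
        funext n; simp; exact em _
      rw [this]; rfl

noncomputable instance : BooleanAlgebra PowModFin :=
  DistribLattice.booleanAlgebraOfComplemented _

/-- A subset of `P(ω)/fin` is a (Boolean) subalgebra if it contains `⊥` and `⊤`
and is closed under `⊓`, `⊔` and complementation. -/
def IsBoolSubalgebra (S : Set PowModFin) : Prop :=
  ⊥ ∈ S ∧ ⊤ ∈ S ∧ (∀ a ∈ S, ∀ b ∈ S, a ⊓ b ∈ S) ∧
    (∀ a ∈ S, ∀ b ∈ S, a ⊔ b ∈ S) ∧ (∀ a ∈ S, aᶜ ∈ S)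

/-- The Boolean algebra (subalgebra) `S` embeds into the subalgebra `T`:
there is a map, injective on `S` and mapping `S` into `T`, which preserves
`⊓`, `⊔`, complement, `⊥` and `⊤` (the operations of the subalgebras being
those induced from `P(ω)/fin`). -/
def BAEmbeds (S T : Set PowModFin) : Prop :=
  ∃ f : PowModFin → PowModFin, Set.MapsTo f S T ∧ Set.InjOn f S ∧
    f ⊥ = ⊥ ∧ f ⊤ = ⊤ ∧
    (∀ a ∈ S, ∀ b ∈ S, f (a ⊓ b) = f a ⊓ f b) ∧
    (∀ a ∈ S, ∀ b ∈ S, f (a ⊔ b) = f a ⊔ f b) ∧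
    (∀ a ∈ S, f aᶜ = (f a)ᶜ)

open Cardinal

/-- `A` is a union of atoms of the partition of `ℚ` cut out by the points of `G`. -/
def SupportedBy (G : Finset ℝ) (A : Set ℚ) : Prop :=
  ∀ p q : ℚ, (∀ g ∈ G, (p : ℝ) < g ↔ (q : ℝ) < g) → (p ∈ A ↔ q ∈ A)

/-- The interval algebra on `ℚ` with endpoints in `E`. -/
def intervalAlgebra (E : Set ℝ) : Set (Set ℚ) :=
  {A | ∃ G : Finset ℝ, (G : Set ℝ) ⊆ E ∧ SupportedBy G A}

theorem SupportedBy.mono {G H : Finset ℝ} {A : Set ℚ} (hGH : G ⊆ H) (h : SupportedBy G A) :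
    SupportedBy H A :=
  fun p q hpq => h p q fun g hg => hpq g (hGH hg)

theorem SupportedBy.compl {G : Finset ℝ} {A : Set ℚ} (h : SupportedBy G A) :
    SupportedBy G Aᶜ :=
  fun p q hpq => not_congr (h p q hpq)

theorem SupportedBy.inter {G : Finset ℝ} {A B : Set ℚ} (hA : SupportedBy G A)
    (hB : SupportedBy G B) : SupportedBy G (A ∩ B) :=
  fun p q hpq => and_congr (hA p q hpq) (hB p q hpq)

theorem intervalAlgebra_mono {E F : Set ℝ} (h : E ⊆ F) :
    intervalAlgebra E ⊆ intervalAlgebra F :=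
  fun _ ⟨G, hG, hA⟩ => ⟨G, hG.trans h, hA⟩

theorem compl_mem_intervalAlgebra {E : Set ℝ} {A : Set ℚ} (h : A ∈ intervalAlgebra E) :
    Aᶜ ∈ intervalAlgebra E := by
  obtain ⟨G, hG, hA⟩ := h
  exact ⟨G, hG, hA.compl⟩

theorem inter_mem_intervalAlgebra {E : Set ℝ} {A B : Set ℚ} (hA : A ∈ intervalAlgebra E)
    (hB : B ∈ intervalAlgebra E) : A ∩ B ∈ intervalAlgebra E := by
  classical
  obtain ⟨G, hG, hA⟩ := hA
  obtain ⟨H, hH, hB⟩ := hB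
  refine ⟨G ∪ H, by simp [hG, hH], ?_⟩
  exact (hA.mono Finset.subset_union_left).inter (hB.mono Finset.subset_union_right)

theorem union_mem_intervalAlgebra {E : Set ℝ} {A B : Set ℚ} (hA : A ∈ intervalAlgebra E)
    (hB : B ∈ intervalAlgebra E) : A ∪ B ∈ intervalAlgebra E := by
  have := compl_mem_intervalAlgebra
    (inter_mem_intervalAlgebra (compl_mem_intervalAlgebra hA) (compl_mem_intervalAlgebra hB))
  rwa [Set.compl_inter, compl_compl, compl_compl] at this

theorem empty_mem_intervalAlgebra (E : Set ℝ) : ∅ ∈ intervalAlgebra E :=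
  ⟨∅, by simp, fun _ _ _ => Iff.rfl⟩

theorem univ_mem_intervalAlgebra (E : Set ℝ) : Set.univ ∈ intervalAlgebra E :=
  ⟨∅, by simp, fun _ _ _ => Iff.rfl⟩

/-- The rationals below a real number. -/
def lowerCut (x : ℝ) : Set ℚ := {q | (q : ℝ) < x}

theorem lowerCut_mem_intervalAlgebra {E : Set ℝ} {x : ℝ} (hx : x ∈ E) :
    lowerCut x ∈ intervalAlgebra E :=
  ⟨{x}, by simpa using hx, fun _ _ h => h x (by simp)⟩

theorem lowerCut_mono : Monotone lowerCut :=
  fun _ _ h _ hq => lt_of_lt_of_le hq h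

theorem lowerCut_injective : Function.Injective lowerCut := by
  have key : ∀ x y : ℝ, x < y → lowerCut x ≠ lowerCut y := by
    intro x y h heq
    obtain ⟨q, h₁, h₂⟩ := exists_rat_btwn h
    have : q ∈ lowerCut x := heq ▸ h₂
    exact lt_asymm h₁ this
  intro x y h
  rcases lt_trichotomy x y with hlt | heq | hlt
  · exact (key _ _ hlt h).elim
  · exact heq
  · exact (key _ _ hlt h.symm).elim

/-- A point `y` that is not needed for some support of `A` is not needed for any support. -/
theorem SupportedBy.erase {G H : Finset ℝ} {A : Set ℚ} {y : ℝ} (hG : SupportedBy G A)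
    (hH : SupportedBy H A) (hy : y ∉ H) : SupportedBy (G.erase y) A := by
  have key : ∀ p q : ℚ, p < q → (∀ g ∈ G.erase y, (p : ℝ) < g ↔ (q : ℝ) < g) →
      (p ∈ A ↔ q ∈ A) := by
    intro p q hpq hsep
    have hpq' : (p : ℝ) < q := by exact_mod_cast hpq
    by_cases hy' : (p : ℝ) < y ∧ y ≤ q
    swap
    · refine hG p q fun g hg => ?_
      by_cases hgy : g = y
      · subst hgy
        grind
      · exact hsep g (Finset.mem_erase.2 ⟨hgy, hg⟩)
    obtain ⟨hpy, hyq⟩ := hy'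
    obtain ⟨δ, hδ, hball⟩ :=
      Metric.isOpen_iff.1 H.finite_toSet.isClosed.isOpen_compl y (by simpa using hy)
    have hfar : ∀ g ∈ H, g ≤ y - δ ∨ y + δ ≤ g := by
      intro g hg
      by_contra! hcon
      have hgy : g ∈ Metric.ball y δ := by
        rw [Metric.mem_ball, Real.dist_eq, abs_lt]
        constructor <;> linarith [hcon.1, hcon.2]
      exact hball hgy hg
    obtain ⟨a, ha₁, ha₂⟩ := exists_rat_btwn (max_lt hpy (sub_lt_self y hδ))
    obtain ⟨ha₀, ha₁⟩ := max_lt_iff.1 ha₁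
    obtain ⟨b, hb₁, hb₂, hb₃⟩ : ∃ b : ℚ, y ≤ b ∧ (b : ℝ) ≤ q ∧ (b : ℝ) < y + δ := by
      rcases hyq.eq_or_lt with heq | hlt
      · exact ⟨q, hyq, le_rfl, by linarith⟩
      · obtain ⟨b, h₁, h₂⟩ := exists_rat_btwn (lt_min hlt (lt_add_of_pos_right y hδ))
        exact ⟨b, h₁.le, (lt_min_iff.1 h₂).1.le, (lt_min_iff.1 h₂).2⟩
    have h₁ : p ∈ A ↔ a ∈ A := by
      refine hG p a fun g hg => ?_
      by_cases hgy : g = y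
      · subst hgy; simp [hpy, ha₂]
      · have := hsep g (Finset.mem_erase.2 ⟨hgy, hg⟩)
        constructor
        · intro h; linarith [this.1 h]
        · intro h; linarith
    have h₂ : a ∈ A ↔ b ∈ A := by
      refine hH a b fun g hg => ?_
      rcases hfar g hg with h | h
      · constructor <;> intro h' <;> linarith
      · constructor <;> intro h' <;> linarith
    have h₃ : b ∈ A ↔ q ∈ A := by
      refine hG b q fun g hg => ?_
      by_cases hgy : g = y
      · subst hgy
        constructor <;> intro h' <;> linarith
      · have := hsep g (Finset.mem_erase.2 ⟨hgy, hg⟩)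
        constructor
        · intro h; exact this.1 (by linarith)
        · intro h; linarith
    exact h₁.trans (h₂.trans h₃)
  intro p q hsep
  rcases lt_trichotomy p q with h | h | h
  · exact key p q h hsep
  · rw [h]
  · exact (key q p h fun g hg => (hsep g hg).symm).symm

theorem mem_intervalAlgebra_of_forall_notMem {U : Set ℝ} {A : Set ℚ}
    (hA : A ∈ intervalAlgebra Set.univ) (h : ∀ y ∉ U, A ∈ intervalAlgebra {y}ᶜ) :
    A ∈ intervalAlgebra U := by
  classical
  obtain ⟨G, -, hG⟩ := hA
  induction G using Finset.strongInduction with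
  | H G ih =>
    by_cases hGU : (G : Set ℝ) ⊆ U
    · exact ⟨G, hGU, hG⟩
    · obtain ⟨y, hyG, hyU⟩ := Set.not_subset.1 hGU
      obtain ⟨H, hH, hHA⟩ := h y hyU
      exact ih _ (Finset.erase_ssubset hyG) (hG.erase hHA fun hy => hH hy rfl)

theorem mk_finset_lt_continuum {α : Type} (h : #α < 𝔠) : #(Finset α) < 𝔠 := by
  rcases finite_or_infinite α with _ | _
  · exact (lt_aleph0_of_finite _).trans aleph0_lt_continuum
  · rwa [mk_finset_of_infinite]

theorem mk_intervalAlgebra_lt_continuum {U : Set ℝ} (hU : #U < 𝔠) :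
    #(intervalAlgebra U) < 𝔠 := by
  classical
  let F : Finset U × Finset (Finset U) → Set ℚ :=
    fun P => {q | P.1.filter (fun g : U => (q : ℝ) < g) ∈ P.2}
  have hsub : intervalAlgebra U ⊆ Set.range F := by
    rintro A ⟨G, hG, hA⟩
    lift G to Finset U using hG
    refine ⟨(G, G.powerset.filter fun T => ∃ q ∈ A, G.filter (fun g : U => (q : ℝ) < g) = T), ?_⟩
    ext q
    simp only [F, Finset.mem_filter, Finset.mem_powerset, Finset.filter_subset, true_and,
      Set.mem_ofPred_eq]
    constructor
    · rintro ⟨p, hp, hpq⟩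
      refine (hA p q fun g hg => ?_).1 hp
      obtain ⟨g, hg, rfl⟩ := Finset.mem_image.1 hg
      have h : g ∈ G → ((p : ℝ) < g ↔ (q : ℝ) < g) := by
        simpa using Finset.ext_iff.1 hpq g
      exact h (by simpa using hg)
    · exact fun hq => ⟨q, hq, rfl⟩
  refine (mk_le_mk_of_subset hsub).trans_lt (mk_range_le.trans_lt ?_)
  rw [mk_prod, lift_id, lift_id]
  exact mul_lt_of_lt aleph0_le_continuum (mk_finset_lt_continuum hU)
    (mk_finset_lt_continuum (mk_finset_lt_continuum hU))

/-- Codes for monotone maps from sets of reals to `Set ℚ`: for every rational `q`, the up-set of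
points whose image contains `q` is recorded by the rationals below it and possibly its minimum. -/
abbrev MonotoneCode : Type := ℚ → Set ℚ × Option ℝ

/-- The map described by a code. -/
def MonotoneCode.decode (c : MonotoneCode) (x : ℝ) : Set ℚ :=
  {q | (∃ r ∈ (c q).1, (r : ℝ) < x) ∨ (c q).2 = some x}

theorem mk_monotoneCode : #MonotoneCode = 𝔠 := by
  have h : 𝔠 + 1 = (𝔠 : Cardinal.{0}) :=
    add_eq_left aleph0_le_continuum (one_le_aleph0.trans aleph0_le_continuum)
  simp [MonotoneCode, mk_real, h]

theorem exists_decode_eq {S : Set ℝ} {h : ℝ → Set ℚ} (hh : MonotoneOn h S) :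
    ∃ c : MonotoneCode, ∀ x ∈ S, c.decode x = h x := by
  classical
  refine ⟨fun q => ({r | ∀ x ∈ S, (r : ℝ) < x → q ∈ h x},
    if hq : ∃ m, IsLeast {x ∈ S | q ∈ h x} m then some hq.choose else none), fun x hx => ?_⟩
  ext q
  simp only [MonotoneCode.decode, Set.mem_ofPred_eq]
  constructor
  · rintro (⟨r, hr, hrx⟩ | hm)
    · exact hr x hx hrx
    · split_ifs at hm with hq
      · rw [Option.some_inj] at hm
        exact hm ▸ hq.choose_spec.1.2
  · intro hqx
    by_cases hleast : IsLeast {x ∈ S | q ∈ h x} x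
    · right
      have hq : ∃ m, IsLeast {x ∈ S | q ∈ h x} m := ⟨x, hleast⟩
      rw [dif_pos hq, hq.choose_spec.unique hleast]
    · left
      obtain ⟨y, ⟨hy, hqy⟩, hyx⟩ : ∃ y ∈ {x ∈ S | q ∈ h x}, y < x := by
        by_contra! hcon
        exact hleast ⟨⟨hx, hqx⟩, hcon⟩
      obtain ⟨r, hyr, hrx⟩ := exists_rat_btwn hyx
      exact ⟨r, fun z hz hrz => hh hy hz (hyr.trans hrz).le hqy, hrx⟩

/-- Transfinite recursion where each value only has to be chosen in terms of the previous ones. -/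
theorem exists_forall_image_Iio {ι α : Type*} [LinearOrder ι] [WellFoundedLT ι]
    (P : ι → Set α → α → Prop)
    (hP : ∀ i (g : Set.Iio i → α), ∃ a, P i (Set.range g) a) :
    ∃ f : ι → α, ∀ i, P i (f '' Set.Iio i) (f i) := by
  let F : ∀ i, (∀ j, j < i → α) → α := fun i g => (hP i fun j => g j j.2).choose
  refine ⟨wellFounded_lt.fix F, fun i => ?_⟩
  rw [Set.image_eq_range, WellFounded.fix_eq]
  exact (hP i fun j => wellFounded_lt.fix F j).choose_spec

theorem exists_disjoint_generic_family :
    ∃ S : ℝ → Set ℝ, Pairwise (Function.onFun Disjoint S) ∧ (∀ r, #(S r) = 𝔠) ∧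
      ∀ (c : MonotoneCode) (r : ℝ), (∃ x ∈ S r, ∃ y ∈ S r, c.decode x ∉ intervalAlgebra {y}ᶜ) ∨
        ∃ U : Set ℝ, #U < 𝔠 ∧ ∀ x ∉ U, ∀ y ∉ U, c.decode x ∈ intervalAlgebra {y}ᶜ := by
  let ι : Type := (ord 𝔠).ToType
  have hι : #ι = 𝔠 := mk_ord_toType 𝔠
  have hIio : ∀ i : ι, #(Set.Iio i) < 𝔠 := fun i => by
    simpa [hι] using mk_Iio_lt i (by simp [ι])
  -- The last factor repeats every task continuum many times, which makes each `S r` large.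
  obtain ⟨e⟩ : Nonempty (ι ≃ MonotoneCode × ℝ × ℝ) := by
    rw [← Cardinal.eq, hι, mk_prod, mk_monotoneCode]
    simp [mk_real]
  let coords : Set (ℝ × ℝ) → Set ℝ := fun s => Prod.fst '' s ∪ Prod.snd '' s
  let Q : ι → ℝ → ℝ → Prop := fun i x y => (e i).1.decode x ∉ intervalAlgebra {y}ᶜ
  have hcoords : ∀ (i : ι) (g : Set.Iio i → ℝ × ℝ), #(coords (Set.range g)) < 𝔠 := by
    intro i g
    have hg : #(Set.range g) < 𝔠 := mk_range_le.trans_lt (hIio i)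
    exact (mk_union_le _ _).trans_lt (add_lt_of_lt aleph0_le_continuum
      (mk_image_le.trans_lt hg) (mk_image_le.trans_lt hg))
  obtain ⟨f, hf⟩ := exists_forall_image_Iio
    (fun (i : ι) (s : Set (ℝ × ℝ)) (a : ℝ × ℝ) => a.1 ∉ coords s ∧ a.2 ∉ coords s ∧
      ((∃ x ∉ coords s, ∃ y ∉ coords s, Q i x y) → Q i a.1 a.2)) (by
    intro i g
    by_cases h : ∃ x ∉ coords (Set.range g), ∃ y ∉ coords (Set.range g), Q i x y
    · obtain ⟨x, hx, y, hy, hxy⟩ := h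
      exact ⟨(x, y), hx, hy, fun _ => hxy⟩
    · obtain ⟨x, hx⟩ : ∃ x, x ∉ coords (Set.range g) := by
        by_contra! hall
        have := hcoords i g
        rw [Set.eq_univ_of_forall hall, mk_univ, mk_real] at this
        exact this.false
      exact ⟨(x, x), hx, hx, fun h' => (h h').elim⟩)
  have hlt : ∀ i j, j < i → ∀ z, z = (f j).1 ∨ z = (f j).2 → z ∈ coords (f '' Set.Iio i) := by
    rintro i j hji z (rfl | rfl)
    · exact Or.inl ⟨_, ⟨j, hji, rfl⟩, rfl⟩
    · exact Or.inr ⟨_, ⟨j, hji, rfl⟩, rfl⟩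
  have hnotMem : ∀ i z, z = (f i).1 ∨ z = (f i).2 → z ∉ coords (f '' Set.Iio i) := by
    rintro i z (rfl | rfl)
    exacts [(hf i).1, (hf i).2.1]
  have hinj : ∀ i j z, (z = (f i).1 ∨ z = (f i).2) → (z = (f j).1 ∨ z = (f j).2) → i = j := by
    intro i j z hi hj
    rcases lt_trichotomy i j with h | h | h
    · exact (hnotMem j z hj (hlt j i h z hi)).elim
    · exact h
    · exact (hnotMem i z hi (hlt i j h z hj)).elim
  refine ⟨fun r => {z | ∃ i, (e i).2.1 = r ∧ (z = (f i).1 ∨ z = (f i).2)}, ?_, ?_, ?_⟩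
  · intro r s hrs
    refine Set.disjoint_left.2 ?_
    rintro z ⟨i, hi, hzi⟩ ⟨j, hj, hzj⟩
    obtain rfl := hinj i j z hzi hzj
    exact hrs (hi.symm.trans hj)
  · intro r
    refine le_antisymm ((mk_set_le _).trans_eq mk_real) ?_
    rw [← mk_real]
    refine mk_le_of_injective (α := ℝ)
      (f := fun t => ⟨(f (e.symm (fun _ => (∅, none), r, t))).1, _, by simp, Or.inl rfl⟩) ?_
    intro t u htu
    have := hinj _ _ _ (Or.inl rfl) (Or.inl (Subtype.ext_iff.1 htu))
    simpa using this
  · intro c r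
    set i := e.symm (c, r, 0) with hi
    have hei : e i = (c, r, 0) := by simp [hi]
    by_cases h : ∃ x ∉ coords (f '' Set.Iio i), ∃ y ∉ coords (f '' Set.Iio i), Q i x y
    · have hQ := (hf i).2.2 h
      simp only [Q, hei] at hQ
      exact Or.inl ⟨_, ⟨i, by simp [hei], Or.inl rfl⟩, _, ⟨i, by simp [hei], Or.inr rfl⟩, hQ⟩
    · right
      refine ⟨coords (f '' Set.Iio i), ?_, fun x hx y hy => ?_⟩
      · rw [Set.image_eq_range]
        exact hcoords i _
      · by_contra hxy
        refine h ⟨x, hx, y, hy, ?_⟩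
        simpa only [Q, hei] using hxy

theorem not_exists_monotoneOn_injOn {S E : Set ℝ} (hS : #S = 𝔠) (hSE : Disjoint S E)
    (hgen : ∀ c : MonotoneCode, (∃ x ∈ S, ∃ y ∈ S, c.decode x ∉ intervalAlgebra {y}ᶜ) ∨
        ∃ U : Set ℝ, #U < 𝔠 ∧ ∀ x ∉ U, ∀ y ∉ U, c.decode x ∈ intervalAlgebra {y}ᶜ)
    {h : ℝ → Set ℚ} (hmono : MonotoneOn h S) (hinj : Set.InjOn h S)
    (hmaps : Set.MapsTo h S (intervalAlgebra E)) : False := by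
  obtain ⟨c, hc⟩ := exists_decode_eq hmono
  rcases hgen c with ⟨x, hx, y, hy, hxy⟩ | ⟨U, hU, hUc⟩
  · rw [hc x hx] at hxy
    refine hxy (intervalAlgebra_mono ?_ (hmaps hx))
    rintro z hz rfl
    exact hSE.le_bot ⟨hy, hz⟩
  · have hmaps' : Set.MapsTo h (S \ U) (intervalAlgebra U) := by
      rintro x ⟨hxS, hxU⟩
      refine mem_intervalAlgebra_of_forall_notMem
        (intervalAlgebra_mono (Set.subset_univ _) (hmaps hxS)) fun y hy => ?_
      rw [← hc x hxS]
      exact hUc x hxU y hy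
    have hlt : #(S \ U : Set ℝ) < 𝔠 :=
      (mk_le_of_injective (f := hmaps'.restrict)
        ((hmaps'.restrict_inj).2 (hinj.mono Set.sdiff_subset))).trans_lt
        (mk_intervalAlgebra_lt_continuum hU)
    have : #S ≤ #(S \ U : Set ℝ) + #U := by
      refine (mk_le_mk_of_subset ?_).trans (mk_union_le _ _)
      rw [Set.sdiff_union_self]
      exact Set.subset_union_left
    exact (this.trans_lt (add_lt_of_lt aleph0_le_continuum hlt hU)).ne hS

/-- The embedding of `Set ℚ` into `P(ω)/fin` obtained by blowing up every rational to an
infinite subset of `ℕ`. -/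
noncomputable def blowUp (A : Set ℚ) : PowModFin :=
  ((fun n => (Denumerable.eqv ℚ).symm n.unpair.1 ∈ A : ℕ → Prop) : PowModFin)

theorem blowUp_inter (A B : Set ℚ) : blowUp (A ∩ B) = blowUp A ⊓ blowUp B := rfl

theorem blowUp_union (A B : Set ℚ) : blowUp (A ∪ B) = blowUp A ⊔ blowUp B := rfl

theorem blowUp_empty : blowUp ∅ = ⊥ := rfl

theorem blowUp_univ : blowUp Set.univ = ⊤ := rfl

theorem blowUp_compl (A : Set ℚ) : blowUp Aᶜ = (blowUp A)ᶜ := by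
  symm
  apply IsCompl.compl_eq
  apply IsCompl.of_eq
  · rw [← blowUp_inter, Set.inter_compl_self, blowUp_empty]
  · rw [← blowUp_union, Set.union_compl_self, blowUp_univ]

theorem blowUp_le_iff {A B : Set ℚ} : blowUp A ≤ blowUp B ↔ A ⊆ B := by
  constructor
  · intro h q hq
    have h' : ∀ᶠ n : ℕ in cofinite, (Denumerable.eqv ℚ).symm n.unpair.1 ∈ A →
      (Denumerable.eqv ℚ).symm n.unpair.1 ∈ B := h
    have hinj : Function.Injective fun m => Nat.pair (Denumerable.eqv ℚ q) m := fun a b hab =>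
      (Nat.pair_eq_pair.1 hab).2
    obtain ⟨m, hm⟩ := (hinj.tendsto_cofinite.eventually h').exists
    simpa only [Nat.unpair_pair, Equiv.symm_apply_apply, hq, true_imp_iff] using hm
  · intro h
    rw [← inf_eq_left, ← blowUp_inter, Set.inter_eq_left.2 h]

theorem blowUp_injective : Function.Injective blowUp := fun _ _ h =>
  (blowUp_le_iff.1 h.le).antisymm (blowUp_le_iff.1 h.ge)

theorem isBoolSubalgebra_blowUp_image (E : Set ℝ) :
    IsBoolSubalgebra (blowUp '' intervalAlgebra E) := by
  refine ⟨⟨_, empty_mem_intervalAlgebra E, blowUp_empty⟩,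
    ⟨_, univ_mem_intervalAlgebra E, blowUp_univ⟩, ?_, ?_, ?_⟩
  · rintro _ ⟨A, hA, rfl⟩ _ ⟨B, hB, rfl⟩
    exact ⟨_, inter_mem_intervalAlgebra hA hB, blowUp_inter A B⟩
  · rintro _ ⟨A, hA, rfl⟩ _ ⟨B, hB, rfl⟩
    exact ⟨_, union_mem_intervalAlgebra hA hB, blowUp_union A B⟩
  · rintro _ ⟨A, hA, rfl⟩
    exact ⟨_, compl_mem_intervalAlgebra hA, blowUp_compl A⟩

theorem BAEmbeds.exists_monotoneOn_injOn {S E : Set ℝ}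
    (h : BAEmbeds (blowUp '' intervalAlgebra S) (blowUp '' intervalAlgebra E)) :
    ∃ h : ℝ → Set ℚ, MonotoneOn h S ∧ Set.InjOn h S ∧ Set.MapsTo h S (intervalAlgebra E) := by
  obtain ⟨f, hmaps, hinj, -, -, hinf, -, -⟩ := h
  have hmem : ∀ x ∈ S, blowUp (lowerCut x) ∈ blowUp '' intervalAlgebra S := fun x hx =>
    ⟨_, lowerCut_mem_intervalAlgebra hx, rfl⟩
  choose! g hgE hgf using fun x hx => hmaps (hmem x hx)
  refine ⟨g, fun x hx y hy hxy => ?_, fun x hx y hy hxy => ?_, hgE⟩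
  · rw [← blowUp_le_iff, hgf x hx, hgf y hy, ← inf_eq_left, ← hinf _ (hmem x hx) _ (hmem y hy),
      inf_eq_left.2 (blowUp_le_iff.2 (lowerCut_mono hxy))]
  · refine lowerCut_injective (blowUp_injective (hinj (hmem x hx) (hmem y hy) ?_))
    rw [← hgf x hx, ← hgf y hy, hxy]

theorem BAEmbeds.mono_left {S S' T : Set PowModFin} (hS : S' ⊆ S) (h : BAEmbeds S T) :
    BAEmbeds S' T := by
  obtain ⟨f, hmaps, hinj, hbot, htop, hinf, hsup, hcompl⟩ := h
  exact ⟨f, hmaps.mono_left hS, hinj.mono hS, hbot, htop,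
    fun a ha b hb => hinf a (hS ha) b (hS hb), fun a ha b hb => hsup a (hS ha) b (hS hb),
    fun a ha => hcompl a (hS ha)⟩

/-- There is a family `(B_X)`, indexed by the subsets `X` of `ℝ` (a set of
cardinality `𝔠`), of Boolean subalgebras of `P(ω)/fin` such that for all
`X, Y ⊆ ℝ`: if `X ⊆ Y` then `B_Y` is a subalgebra of `B_X`, and if `X ⊄ Y`
then there is no Boolean algebra embedding of `B_Y` into `B_X`. -/
theorem many_subalgebras_of_PowModFin :
    ∃ B : Set ℝ → Set PowModFin,
      (∀ X, IsBoolSubalgebra (B X)) ∧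
      (∀ X Y : Set ℝ, X ⊆ Y → B Y ⊆ B X) ∧
      (∀ X Y : Set ℝ, ¬ X ⊆ Y → ¬ BAEmbeds (B Y) (B X)) := by
  obtain ⟨S, hdisj, hcard, hgen⟩ := exists_disjoint_generic_family
  refine ⟨fun X => blowUp '' intervalAlgebra (⋃ r ∈ Xᶜ, S r),
    fun X => isBoolSubalgebra_blowUp_image _, fun X Y hXY => ?_, fun X Y hXY hemb => ?_⟩
  · exact Set.image_mono (intervalAlgebra_mono
      (Set.biUnion_subset_biUnion_left (Set.compl_subset_compl.2 hXY)))
  · obtain ⟨r, hrX, hrY⟩ := Set.not_subset.1 hXY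
    have hsub : S r ⊆ ⋃ r ∈ Yᶜ, S r := Set.subset_biUnion_of_mem (u := S) hrY
    obtain ⟨h, hmono, hinj, hmaps⟩ :=
      (hemb.mono_left (Set.image_mono (intervalAlgebra_mono hsub))).exists_monotoneOn_injOn
    refine not_exists_monotoneOn_injOn (hcard r) ?_ (fun c => hgen c r) hmono hinj hmaps
    refine Set.disjoint_iUnion₂_right.2 fun s hs => hdisj ?_
    rintro rfl
    exact hs hrX
end

section
/- There is a family (B_r)_{r ∈ ℝ} of Boolean subalgebras of P(ω)/fin such that for all real numbers r < s: B_s is a subalgebra of B_r, and there is no Boolean algebra embedding of B_r into B_s (so the chain is strictly decreasing and has the order type of the real line). -/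
open Filter

open Set Cardinal

/-- The real points near which a set of rationals is not locally constant. -/
def ratBdry (S : Set ℚ) : Set ℝ :=
  closure ((↑) '' S : Set ℝ) ∩ closure ((↑) '' Sᶜ : Set ℝ)

theorem ratBdry_compl (S : Set ℚ) : ratBdry Sᶜ = ratBdry S := by
  simp [ratBdry, inter_comm]

theorem ratBdry_empty : ratBdry ∅ = ∅ := by simp [ratBdry]

theorem ratBdry_union_subset (S T : Set ℚ) : ratBdry (S ∪ T) ⊆ ratBdry S ∪ ratBdry T := by
  rintro x ⟨hx, hx'⟩
  rw [image_union, closure_union] at hx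
  refine hx.imp (fun h => ⟨h, ?_⟩) (fun h => ⟨h, ?_⟩) <;>
    refine closure_mono (image_mono ?_) hx' <;> simp

theorem ratBdry_lt_subset (x : ℝ) : ratBdry {q : ℚ | (q : ℝ) < x} ⊆ {x} := by
  rintro y ⟨hy, hy'⟩
  have h1 : y ∈ Iic x := by
    refine closure_minimal ?_ isClosed_Iic hy
    rintro _ ⟨q, hq, rfl⟩
    exact le_of_lt (show (q : ℝ) < x from hq)
  have h2 : y ∈ Ici x := by
    refine closure_minimal ?_ isClosed_Ici hy'
    rintro _ ⟨q, hq, rfl⟩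
    exact not_lt.1 (show ¬ (q : ℝ) < x from hq)
  exact le_antisymm h1 h2

theorem mem_iff_mem_of_disjoint_ratBdry {S : Set ℚ} {p q : ℚ} (hpq : p ≤ q)
    (h : Disjoint (ratBdry S) (Icc (p : ℝ) q)) : p ∈ S ↔ q ∈ S := by
  have hpq' : (p : ℝ) ≤ q := by exact_mod_cast hpq
  have key := isPreconnected_closed_iff.1 (isPreconnected_Icc (a := (p : ℝ)) (b := q))
    (closure ((↑) '' S)) (closure ((↑) '' Sᶜ)) isClosed_closure isClosed_closure (by
      rw [← closure_union, ← image_union, union_compl_self, image_univ,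
        Rat.denseRange_cast.closure_range]
      exact subset_univ _)
  have hmem : ∀ {T : Set ℚ} {t : ℚ}, t ∈ T → (t : ℝ) ∈ closure ((↑) '' T : Set ℝ) :=
    fun ht => subset_closure (mem_image_of_mem _ ht)
  have hno : ¬ (Icc (p : ℝ) q ∩ (closure ((↑) '' S) ∩ closure ((↑) '' Sᶜ))).Nonempty := by
    rintro ⟨z, hz, hz'⟩
    exact disjoint_left.1 h hz' hz
  constructor
  · intro hp
    by_contra hq
    exact hno (key ⟨p, left_mem_Icc.2 hpq', hmem hp⟩ ⟨q, right_mem_Icc.2 hpq', hmem hq⟩)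
  · intro hq
    by_contra hp
    exact hno (key ⟨q, right_mem_Icc.2 hpq', hmem hq⟩ ⟨p, left_mem_Icc.2 hpq', hmem hp⟩)

theorem finite_setOf_ratBdry_subset {F : Set ℝ} (hF : F.Finite) :
    {S : Set ℚ | ratBdry S ⊆ F}.Finite := by
  let σ : ℚ → Set ℝ × Set ℝ := fun q => (F ∩ Iio (q : ℝ), F ∩ Iic (q : ℝ))
  have hfin : (𝒫 (𝒫 F ×ˢ 𝒫 F)).Finite := (hF.finite_subsets.prod hF.finite_subsets).finite_subsets
  have hσ : ∀ S : Set ℚ, ratBdry S ⊆ F → ∀ p q, p ≤ q → σ p = σ q → (p ∈ S ↔ q ∈ S) := by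
    intro S hS p q hpq h
    rcases hpq.eq_or_lt with rfl | hpq'
    · rfl
    have hlt : (p : ℝ) < q := by exact_mod_cast hpq'
    refine mem_iff_mem_of_disjoint_ratBdry hpq (disjoint_left.2 fun z hz hzpq => ?_)
    have h1 : z ∈ F ∩ Iio (p : ℝ) ↔ z ∈ F ∩ Iio (q : ℝ) :=
      Set.ext_iff.1 (congrArg Prod.fst h) z
    have h2 : z ∈ F ∩ Iic (p : ℝ) ↔ z ∈ F ∩ Iic (q : ℝ) :=
      Set.ext_iff.1 (congrArg Prod.snd h) z
    simp only [mem_inter_iff, hS hz, true_and, mem_Iio, mem_Iic] at h1 h2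
    have hqz : (q : ℝ) ≤ z := not_lt.1 fun h' => hzpq.1.not_gt (h1.2 h')
    exact hlt.not_ge (hqz.trans (h2.2 hzpq.2))
  refine Finite.of_finite_image (f := fun S => σ '' S) (hfin.subset ?_) ?_
  · rintro _ ⟨S, -, rfl⟩ _ ⟨q, -, rfl⟩
    exact ⟨inter_subset_left, inter_subset_left⟩
  · have key : ∀ S T : Set ℚ, ratBdry T ⊆ F → σ '' S = σ '' T → S ⊆ T := by
      intro S T hT h p hp
      obtain ⟨q, hq, hqp⟩ : σ p ∈ σ '' T := h ▸ mem_image_of_mem σ hp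
      rcases le_total p q with hpq | hpq
      · exact (hσ T hT p q hpq hqp.symm).2 hq
      · exact (hσ T hT q p hpq hqp).1 hq
    intro S hS T hT h
    exact (key S T hT h).antisymm (key T S hS h.symm)

/-- The sets of rationals which are locally constant off a finite subset of `Y`. -/
def cutAlg (Y : Set ℝ) : Set (Set ℚ) := {S | (ratBdry S).Finite ∧ ratBdry S ⊆ Y}

theorem cutAlg_mono {Y Z : Set ℝ} (h : Y ⊆ Z) : cutAlg Y ⊆ cutAlg Z :=
  fun _ hS => ⟨hS.1, hS.2.trans h⟩

theorem compl_mem_cutAlg {Y : Set ℝ} {S : Set ℚ} (hS : S ∈ cutAlg Y) : Sᶜ ∈ cutAlg Y := by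
  simpa only [cutAlg, mem_ofPred_eq, ratBdry_compl] using hS

theorem union_mem_cutAlg {Y : Set ℝ} {S T : Set ℚ} (hS : S ∈ cutAlg Y) (hT : T ∈ cutAlg Y) :
    S ∪ T ∈ cutAlg Y :=
  ⟨(hS.1.union hT.1).subset (ratBdry_union_subset S T),
    (ratBdry_union_subset S T).trans (union_subset hS.2 hT.2)⟩

theorem inter_mem_cutAlg {Y : Set ℝ} {S T : Set ℚ} (hS : S ∈ cutAlg Y) (hT : T ∈ cutAlg Y) :
    S ∩ T ∈ cutAlg Y := by
  have := compl_mem_cutAlg (union_mem_cutAlg (compl_mem_cutAlg hS) (compl_mem_cutAlg hT))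
  rwa [compl_union, compl_compl, compl_compl] at this

theorem empty_mem_cutAlg (Y : Set ℝ) : ∅ ∈ cutAlg Y := by simp [cutAlg, ratBdry_empty]

theorem univ_mem_cutAlg (Y : Set ℝ) : Set.univ ∈ cutAlg Y := by
  simpa using compl_mem_cutAlg (empty_mem_cutAlg Y)

theorem lt_mem_cutAlg {Y : Set ℝ} {y : ℝ} (hy : y ∈ Y) : {q : ℚ | (q : ℝ) < y} ∈ cutAlg Y :=
  ⟨(finite_singleton y).subset (ratBdry_lt_subset y),
    (ratBdry_lt_subset y).trans (singleton_subset_iff.2 hy)⟩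

theorem mk_cutAlg_lt {Z : Set ℝ} (hZ : #Z < 𝔠) : #(cutAlg Z) < 𝔠 := by
  have hsub : cutAlg Z ⊆ ⋃ F : Finset Z, {S | ratBdry S ⊆ (↑) '' (F : Set Z)} := by
    rintro S ⟨hfin, hS⟩
    have hpre : ((↑) ⁻¹' ratBdry S : Set Z).Finite := hfin.preimage Subtype.val_injective.injOn
    refine mem_iUnion.2 ⟨hpre.toFinset, fun z hz => ?_⟩
    exact ⟨⟨z, hS hz⟩, by simpa using hz, rfl⟩
  have hFin : #(Finset Z) < 𝔠 := by
    rcases finite_or_infinite Z with h | h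
    · exact (lt_aleph0_of_finite _).trans aleph0_lt_continuum
    · rwa [mk_finset_of_infinite]
  calc #(cutAlg Z) ≤ #(⋃ F : Finset Z, {S | ratBdry S ⊆ (↑) '' (F : Set Z)}) :=
      mk_le_mk_of_subset hsub
    _ ≤ Cardinal.sum fun F : Finset Z => #{S | ratBdry S ⊆ (↑) '' (F : Set Z)} :=
      mk_iUnion_le_sum_mk
    _ ≤ Cardinal.sum fun _ : Finset Z => ℵ₀ := Cardinal.sum_le_sum _ _ fun F =>
      (finite_setOf_ratBdry_subset (F.finite_toSet.image _)).lt_aleph0.le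
    _ = #(Finset Z) * ℵ₀ := by simp
    _ < 𝔠 := mul_lt_of_lt aleph0_le_continuum hFin aleph0_lt_continuum

/-- A map from the reals to sets of rationals described by countably many reals. -/
def decodeMono (c : ℚ → Set ℚ × Option ℝ) (z : ℝ) : Set ℚ :=
  {n | (∃ q ∈ (c n).1, (q : ℝ) < z) ∨ (c n).2 = some z}

theorem exists_code_of_isUpperSet {U : Set ℝ} (hU : IsUpperSet U) :
    ∃ c : Set ℚ × Option ℝ, ∀ z, z ∈ U ↔ (∃ q ∈ c.1, (q : ℝ) < z) ∨ c.2 = some z := by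
  by_cases hm : ∃ m, IsLeast U m
  · obtain ⟨m, hm⟩ := hm
    refine ⟨((↑) ⁻¹' U, some m), fun z => ⟨fun hz => ?_, ?_⟩⟩
    · rcases (hm.2 hz).eq_or_lt with rfl | hlt
      · exact Or.inr rfl
      · obtain ⟨q, hq, hq'⟩ := exists_rat_btwn hlt
        exact Or.inl ⟨q, hU hq.le hm.1, hq'⟩
    · rintro (⟨q, hq, hqz⟩ | h)
      · exact hU hqz.le hq
      · exact Option.some.inj h ▸ hm.1
  · refine ⟨((↑) ⁻¹' U, none), fun z => ⟨fun hz => Or.inl ?_, ?_⟩⟩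
    · obtain ⟨y, hy, hyz⟩ : ∃ y ∈ U, y < z := by
        by_contra! h
        exact hm ⟨z, hz, h⟩
      obtain ⟨q, hq, hq'⟩ := exists_rat_btwn hyz
      exact ⟨q, hU hq.le hy, hq'⟩
    · rintro (⟨q, hq, hqz⟩ | h)
      · exact hU hqz.le hq
      · cases h

theorem exists_decodeMono_eq {G : ℝ → Set ℚ} (hG : Monotone G) : ∃ c, decodeMono c = G := by
  have h : ∀ n : ℚ, IsUpperSet {z | n ∈ G z} := fun n _ _ hab ha => hG hab ha
  choose c hc using fun n => exists_code_of_isUpperSet (h n)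
  exact ⟨c, funext fun z => Set.ext fun n => (hc n z).symm⟩

theorem mk_decodeMono_index : #((ℚ → Set ℚ × Option ℝ) × ℝ) = 𝔠 := by
  have h : #(Set ℚ × Option ℝ) = 𝔠 := by
    simp [mk_real, add_eq_left aleph0_le_continuum (one_le_aleph0.trans aleph0_le_continuum)]
  rw [mk_prod, ← power_def, h]
  simp [mk_real]

/-- Recursion along a well-order where each step depends on the set of earlier values. -/
theorem exists_initialSegment_recursion {ι β : Type*} [LinearOrder ι] [WellFoundedLT ι]
    (Q : ι → Set β → β → Prop) (h : ∀ i (p : Iio i → β), ∃ b, Q i (range p) b) :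
    ∃ p : ι → β, ∀ i, Q i (p '' Iio i) (p i) := by
  choose b hb using h
  let p : ι → β := wellFounded_lt.fix fun i rec => b i fun j => rec j j.2
  refine ⟨p, fun i => ?_⟩
  have hp : p i = b i fun j : Iio i => p j := wellFounded_lt.fix_eq _ i
  rw [hp, image_eq_range]
  exact hb i _

/-- The requirement met by a new point `b.1` and a new forbidden point `b.2`, given the set `s` of
previously chosen pairs. -/
structure DiagStep (G : ℝ → Set ℚ) (s : Set (ℝ × ℝ)) (b : ℝ × ℝ) : Prop where
  fst_ne_fst : ∀ a ∈ s, b.1 ≠ a.1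
  fst_ne_snd : ∀ a ∈ s, b.1 ≠ a.2
  snd_ne_fst : ∀ a ∈ s, b.2 ≠ a.1
  snd_mem : #(range G) = 𝔠 → (ratBdry (G b.1)).Finite → b.2 ∈ ratBdry (G b.1)

theorem exists_diagStep (G : ℝ → Set ℚ) {s : Set (ℝ × ℝ)} (hs : #s < 𝔠) :
    ∃ b, DiagStep G s b := by
  let N : Set ℝ := Prod.fst '' s ∪ Prod.snd '' s
  have hN' : #N < 𝔠 := (mk_union_le _ _).trans_lt <|
    add_lt_of_lt aleph0_le_continuum (mk_image_le.trans_lt hs) (mk_image_le.trans_lt hs)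
  have hne : ∀ x ∉ N, ∀ a ∈ s, x ≠ a.1 ∧ x ≠ a.2 := by
    intro x hx a ha
    exact ⟨fun h => hx (Or.inl ⟨a, ha, h.symm⟩), fun h => hx (Or.inr ⟨a, ha, h.symm⟩)⟩
  by_cases hG : #(range G) = 𝔠
  · obtain ⟨x, hxN, hx⟩ : ∃ x ∉ N, G x ∉ cutAlg (Prod.fst '' s) := by
      by_contra! h
      have hsub : range G ⊆ G '' N ∪ cutAlg (Prod.fst '' s) := by
        rintro _ ⟨x, rfl⟩
        by_cases hx : x ∈ N
        · exact Or.inl ⟨x, hx, rfl⟩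
        · exact Or.inr (h x hx)
      refine (((mk_le_mk_of_subset hsub).trans (mk_union_le _ _)).trans_lt ?_).ne hG
      exact add_lt_of_lt aleph0_le_continuum (mk_image_le.trans_lt hN')
        (mk_cutAlg_lt (mk_image_le.trans_lt hs))
    by_cases hfin : (ratBdry (G x)).Finite
    · obtain ⟨e, he, he'⟩ := not_subset.1 fun h => hx ⟨hfin, h⟩
      exact ⟨(x, e), fun a ha => (hne x hxN a ha).1, fun a ha => (hne x hxN a ha).2,
        fun a ha h => he' ⟨a, ha, h.symm⟩, fun _ _ => he⟩
    · exact ⟨(x, x), fun a ha => (hne x hxN a ha).1, fun a ha => (hne x hxN a ha).2,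
        fun a ha => (hne x hxN a ha).1, fun _ h => absurd h hfin⟩
  · obtain ⟨x, hxN⟩ : ∃ x, x ∉ N := by
      by_contra! h
      rw [eq_univ_of_forall h, mk_univ, mk_real] at hN'
      exact hN'.false
    exact ⟨(x, x), fun a ha => (hne x hxN a ha).1, fun a ha => (hne x hxN a ha).2,
      fun a ha => (hne x hxN a ha).1, fun h => absurd h hG⟩

/-- A decreasing chain of sets of reals such that no monotone map with continuum many values sends
the cuts at points of a larger set into the cut algebra of a smaller one. -/
theorem exists_diagonal_chain : ∃ X : ℝ → Set ℝ, (∀ r s, r < s → X s ⊆ X r) ∧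
    (∀ r, #(X r) = 𝔠) ∧ ∀ r s, r < s → ∀ G : ℝ → Set ℚ, Monotone G → #(range G) = 𝔠 →
      ∃ x ∈ X r, G x ∉ cutAlg (X s) := by
  obtain ⟨φ⟩ : Nonempty ((Cardinal.ord 𝔠).ToType ≃ (ℚ → Set ℚ × Option ℝ) × ℝ) :=
    Cardinal.eq.1 (by rw [mk_decodeMono_index, mk_ord_toType])
  obtain ⟨p, hp⟩ := exists_initialSegment_recursion
    (fun i s b => DiagStep (decodeMono (φ i).1) s b)
    (fun i p => exists_diagStep _ (mk_range_le.trans_lt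
      ((mk_Iio_lt i (by simp)).trans_eq (mk_ord_toType 𝔠))))
  have hinj : Function.Injective fun i => (p i).1 := by
    intro i j hij
    rcases lt_trichotomy i j with h | h | h
    · exact absurd hij.symm ((hp j).fst_ne_fst _ ⟨i, h, rfl⟩)
    · exact h
    · exact absurd hij ((hp i).fst_ne_fst _ ⟨j, h, rfl⟩)
  have hforb : ∀ i j, (p i).2 = (p j).1 → j = i := by
    intro i j hij
    rcases lt_trichotomy i j with h | h | h
    · exact absurd hij.symm ((hp j).fst_ne_snd _ ⟨i, h, rfl⟩)
    · exact h.symm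
    · exact absurd hij ((hp i).snd_ne_fst _ ⟨j, h, rfl⟩)
  refine ⟨fun r => (fun i => (p i).1) '' {i | r < (φ i).2}, ?_, ?_, ?_⟩
  · exact fun r s hrs => image_mono fun i hi => hrs.trans hi
  · intro r
    refine le_antisymm ((mk_set_le _).trans_eq mk_real) ?_
    rw [mk_image_eq hinj]
    refine (mk_Ioi_real r).ge.trans (mk_le_of_injective
      (f := fun t : Ioi r => ⟨φ.symm (fun _ => (∅, none), t), by
        rw [mem_ofPred_eq, φ.apply_symm_apply]; exact t.2⟩) ?_)
    intro t t' h
    simpa [Subtype.ext_iff] using h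
  · intro r s hrs G hG hcard
    obtain ⟨c, rfl⟩ := exists_decodeMono_eq hG
    obtain ⟨i, hi⟩ := φ.surjective (c, s)
    refine ⟨(p i).1, ⟨i, by simpa [hi] using hrs, rfl⟩, fun hmem => ?_⟩
    have hstep := (hp i).snd_mem
    rw [hi] at hstep
    obtain ⟨j, hj, hji⟩ := hmem.2 (hstep hcard hmem.1)
    have := hforb i j hji.symm
    subst this
    simp [hi] at hj

theorem exists_infinite_fibers : ∃ π : ℕ → ℚ, ∀ q, (π ⁻¹' {q}).Infinite := by
  obtain ⟨e⟩ : Nonempty (ℕ ≃ ℚ × ℕ) := inferInstance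
  refine ⟨fun n => (e n).1, fun q => ?_⟩
  refine infinite_of_injective_forall_mem (f := fun k => e.symm (q, k)) ?_ (by simp)
  intro a b h
  simpa using h

/-- The homomorphism from sets of rationals to `P(ω)/fin` given by preimage under `π`. -/
def preimageGerm (π : ℕ → ℚ) (S : Set ℚ) : PowModFin := Germ.ofFun fun n => π n ∈ S

section preimageGerm

variable (π : ℕ → ℚ) (S T : Set ℚ)

theorem preimageGerm_inter : preimageGerm π (S ∩ T) = preimageGerm π S ⊓ preimageGerm π T := rfl

theorem preimageGerm_union : preimageGerm π (S ∪ T) = preimageGerm π S ⊔ preimageGerm π T := rfl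

theorem preimageGerm_empty : preimageGerm π ∅ = ⊥ := rfl

theorem preimageGerm_univ : preimageGerm π Set.univ = ⊤ := rfl

theorem preimageGerm_compl : preimageGerm π Sᶜ = (preimageGerm π S)ᶜ := by
  refine (IsCompl.compl_eq (IsCompl.of_eq ?_ ?_)).symm
  · rw [← preimageGerm_inter, inter_compl_self, preimageGerm_empty]
  · rw [← preimageGerm_union, union_compl_self, preimageGerm_univ]

variable {π}

theorem preimageGerm_injective (hπ : ∀ q, (π ⁻¹' {q}).Infinite) :
    Function.Injective (preimageGerm π) := by
  intro S T h
  have h' : ∀ᶠ n in cofinite, (π n ∈ S) = (π n ∈ T) := Germ.coe_eq.1 h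
  ext q
  obtain ⟨n, hn, hn'⟩ := ((frequently_cofinite_iff_infinite.2 (hπ q)).and_eventually h').exists
  have hq : π n = q := hn
  rw [hq] at hn'
  exact iff_of_eq hn'

end preimageGerm

theorem isBoolSubalgebra_image_cutAlg (π : ℕ → ℚ) (Y : Set ℝ) :
    IsBoolSubalgebra (preimageGerm π '' cutAlg Y) := by
  refine ⟨⟨∅, empty_mem_cutAlg Y, preimageGerm_empty π⟩,
    ⟨Set.univ, univ_mem_cutAlg Y, preimageGerm_univ π⟩, ?_, ?_, ?_⟩
  · rintro _ ⟨S, hS, rfl⟩ _ ⟨T, hT, rfl⟩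
    exact ⟨S ∩ T, inter_mem_cutAlg hS hT, preimageGerm_inter π S T⟩
  · rintro _ ⟨S, hS, rfl⟩ _ ⟨T, hT, rfl⟩
    exact ⟨S ∪ T, union_mem_cutAlg hS hT, preimageGerm_union π S T⟩
  · rintro _ ⟨S, hS, rfl⟩
    exact ⟨Sᶜ, compl_mem_cutAlg hS, preimageGerm_compl π S⟩

theorem ratCut_strictMono : StrictMono fun x : ℝ => {q : ℚ | (q : ℝ) < x} := by
  intro x y hxy
  refine ⟨fun q (hq : (q : ℝ) < x) => hq.trans hxy, fun h => ?_⟩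
  obtain ⟨q, hq, hq'⟩ := exists_rat_btwn hxy
  have hqx : (q : ℝ) < x := h hq'
  exact hqx.not_gt hq

/-- An embedding between image algebras yields a monotone map on the reals which sends the points of
`X` injectively to members of `cutAlg Y`. -/
theorem exists_monotone_of_baEmbeds {π : ℕ → ℚ} (hπ : ∀ q, (π ⁻¹' {q}).Infinite) {X Y : Set ℝ}
    (h : BAEmbeds (preimageGerm π '' cutAlg X) (preimageGerm π '' cutAlg Y)) :
    ∃ G : ℝ → Set ℚ, Monotone G ∧ InjOn G X ∧ MapsTo G X (cutAlg Y) := by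
  obtain ⟨f, hmaps, hinj, -, -, hinf, -, -⟩ := h
  let L : ℝ → Set ℚ := fun x => {q : ℚ | (q : ℝ) < x}
  have hL : ∀ x ∈ X, preimageGerm π (L x) ∈ preimageGerm π '' cutAlg X :=
    fun x hx => mem_image_of_mem _ (lt_mem_cutAlg hx)
  choose! g hgY hg using fun x hx => hmaps (hL x hx)
  have hmono : MonotoneOn g X := by
    intro x hx y hy hxy
    refine inter_eq_left.1 (preimageGerm_injective hπ ?_)
    rw [preimageGerm_inter, hg x hx, hg y hy, ← hinf _ (hL x hx) _ (hL y hy),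
      ← preimageGerm_inter, inter_eq_left.2 (ratCut_strictMono.monotone hxy)]
  let G : ℝ → Set ℚ := fun z => {n | ∃ y ∈ X, y ≤ z ∧ n ∈ g y}
  have hG : ∀ x ∈ X, G x = g x := by
    intro x hx
    refine Subset.antisymm ?_ fun n hn => ⟨x, hx, le_rfl, hn⟩
    rintro n ⟨y, hy, hyx, hn⟩
    exact hmono hy hx hyx hn
  refine ⟨G, ?_, ?_, ?_⟩
  · rintro z w hzw n ⟨y, hy, hyz, hn⟩
    exact ⟨y, hy, hyz.trans hzw, hn⟩
  · intro x hx y hy hxy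
    rw [hG x hx, hG y hy] at hxy
    refine ratCut_strictMono.injective (preimageGerm_injective hπ (hinj (hL x hx) (hL y hy) ?_))
    rw [← hg x hx, ← hg y hy, hxy]
  · intro x hx
    rw [hG x hx]
    exact hgY x hx

/-- There is a family `(B_r)_{r ∈ ℝ}` of Boolean subalgebras of `P(ω)/fin`
such that for all reals `r < s`: `B_s` is a subalgebra of `B_r`, and there is
no Boolean algebra embedding of `B_r` into `B_s`; so the chain is strictly
decreasing with the order type of the real line. -/
theorem real_chain_of_subalgebras_of_PowModFin :
    ∃ B : ℝ → Set PowModFin,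
      (∀ r, IsBoolSubalgebra (B r)) ∧
      (∀ r s : ℝ, r < s → B s ⊆ B r ∧ ¬ BAEmbeds (B r) (B s)) := by
  obtain ⟨X, hsub, hcard, hdiag⟩ := exists_diagonal_chain
  obtain ⟨π, hπ⟩ := exists_infinite_fibers
  refine ⟨fun r => preimageGerm π '' cutAlg (X r),
    fun r => isBoolSubalgebra_image_cutAlg π (X r), fun r s hrs => ⟨?_, fun h => ?_⟩⟩
  · exact image_mono (cutAlg_mono (hsub r s hrs))
  · obtain ⟨G, hG, hinj, hmaps⟩ := exists_monotone_of_baEmbeds hπ h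
    have hrange : #(range G) = 𝔠 := by
      refine le_antisymm (mk_range_le.trans_eq mk_real) ?_
      rw [← hcard r, ← mk_image_eq_of_injOn G (X r) hinj]
      exact mk_le_mk_of_subset (image_subset_range G (X r))
    obtain ⟨x, hx, hx'⟩ := hdiag r s hrs G hG hrange
    exact hx' (hmaps hx)
end

section
/- There is a transfinite sequence (B_α)_{α < 𝔠} of Boolean subalgebras of P(ω)/fin, indexed by the ordinals below the continuum, such that for all α < β < 𝔠: B_β is a subalgebra of B_α, and there is no Boolean algebra embedding of B_α into B_β. -/
open Filter

/-- The rational lower cut of a real number. -/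
def ratCut (y : ℝ) : Set ℚ := {p | (p : ℝ) < y}

theorem ratCut_subset_iff {y z : ℝ} : ratCut y ⊆ ratCut z ↔ y ≤ z := by
  refine ⟨fun h => ?_, fun h p hp => lt_of_lt_of_le hp h⟩
  by_contra! hlt
  obtain ⟨q, hq, hq'⟩ := exists_rat_btwn hlt
  exact absurd (h (show q ∈ ratCut y from hq')) (not_lt.2 hq.le)

/-- `s` supports `W` if membership in `W` only depends on the position relative to `s`. -/
def CutSupports (s : Finset ℝ) (W : Set ℚ) : Prop :=
  ∀ p q : ℚ, (∀ y ∈ s, (p : ℝ) < y ↔ (q : ℝ) < y) → (p ∈ W ↔ q ∈ W)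

theorem CutSupports.mono {s t : Finset ℝ} {W : Set ℚ} (h : CutSupports s W) (hst : s ⊆ t) :
    CutSupports t W :=
  fun p q hpq => h p q fun y hy => hpq y (hst hy)

theorem exists_rat_pair_around {t : Finset ℝ} {y : ℝ} (hy : y ∉ t) {p q : ℚ} (hp : (p : ℝ) < y)
    (hq : y ≤ q) : ∃ p' q' : ℚ, p ≤ p' ∧ (p' : ℝ) < y ∧ y ≤ q' ∧ q' ≤ q ∧
      ∀ z ∈ t, (p' : ℝ) < z ↔ (q' : ℝ) < z := by
  have hnhds : (↑t : Set ℝ)ᶜ ∈ nhds y := t.finite_toSet.isClosed.isOpen_compl.mem_nhds hy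
  obtain ⟨ε, hε, hball⟩ := Metric.mem_nhds_iff.1 hnhds
  obtain ⟨a, ha, hay⟩ := exists_rat_btwn (show max (p : ℝ) (y - ε) < y by simp [hp, hε])
  have hb : ∃ b : ℚ, y ≤ b ∧ b ≤ q ∧ (b : ℝ) < y + ε := by
    rcases hq.eq_or_lt with h | h
    · exact ⟨q, hq, le_rfl, by linarith⟩
    · obtain ⟨b, hb, hb'⟩ := exists_rat_btwn (show y < min (q : ℝ) (y + ε) by simp [h, hε])
      exact ⟨b, hb.le, by exact_mod_cast (lt_min_iff.1 hb').1.le, (lt_min_iff.1 hb').2⟩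
  obtain ⟨b, hyb, hbq, hbε⟩ := hb
  rw [max_lt_iff] at ha
  refine ⟨a, b, by exact_mod_cast ha.1.le, hay, hyb, hbq, fun z hz => ⟨fun h => ?_, fun h => ?_⟩⟩
  · by_contra! hzb
    refine hball (show z ∈ Metric.ball y ε from ?_) hz
    rw [Metric.mem_ball, Real.dist_eq, abs_lt]
    constructor <;> linarith [ha.2]
  · linarith

theorem CutSupports.erase {s t : Finset ℝ} {W : Set ℚ} (hs : CutSupports s W)
    (ht : CutSupports t W) {y : ℝ} (hy : y ∉ t) : CutSupports (s.erase y) W := by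
  have key : ∀ p q : ℚ, (p : ℝ) < y → y ≤ q →
      (∀ z ∈ s.erase y, (p : ℝ) < z ↔ (q : ℝ) < z) → (p ∈ W ↔ q ∈ W) := by
    intro p q hp hq hpq
    obtain ⟨p', q', hpp', hp'y, hyq', hq'q, hz⟩ := exists_rat_pair_around hy hp hq
    have h1 : (p : ℝ) ≤ p' := by exact_mod_cast hpp'
    have h2 : (q' : ℝ) ≤ q := by exact_mod_cast hq'q
    refine (hs p p' fun z hzs => ?_).trans ((ht p' q' hz).trans (hs q' q fun z hzs => ?_))
    · by_cases hzy : z = y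
      · subst hzy; exact iff_of_true hp hp'y
      · have := hpq z (Finset.mem_erase.2 ⟨hzy, hzs⟩)
        exact ⟨fun h => by linarith [this.1 h], fun h => by linarith⟩
    · by_cases hzy : z = y
      · subst hzy; exact iff_of_false hyq'.not_gt hq.not_gt
      · have := hpq z (Finset.mem_erase.2 ⟨hzy, hzs⟩)
        exact ⟨fun h => this.1 (by linarith), fun h => by linarith⟩
  intro p q hpq
  rcases lt_or_ge (p : ℝ) y with hp | hp <;> rcases lt_or_ge (q : ℝ) y with hq | hq
  · refine hs p q fun z hz => ?_
    by_cases hzy : z = y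
    · subst hzy; exact iff_of_true hp hq
    · exact hpq z (Finset.mem_erase.2 ⟨hzy, hz⟩)
  · exact key p q hp hq hpq
  · exact (key q p hq hp fun z hz => (hpq z hz).symm).symm
  · refine hs p q fun z hz => ?_
    by_cases hzy : z = y
    · subst hzy; exact iff_of_false hp.not_gt hq.not_gt
    · exact hpq z (Finset.mem_erase.2 ⟨hzy, hz⟩)

theorem CutSupports.inter {s t : Finset ℝ} {W : Set ℚ} (hs : CutSupports s W)
    (ht : CutSupports t W) : CutSupports (s ∩ t) W := by
  have key : ∀ u : Finset ℝ, Disjoint u t → CutSupports (s \ u) W := by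
    intro u
    induction u using Finset.induction_on with
    | empty => simpa using hs
    | insert y u _ ih =>
      intro hd
      rw [Finset.disjoint_insert_left] at hd
      rw [Finset.sdiff_insert]
      exact (ih hd.2).erase ht hd.1
  simpa using key (s \ t) Finset.sdiff_disjoint

/-- The algebra of sets of rationals which are finite unions of half-open intervals with endpoints
in `D`. -/
def cutAlgebra (D : Set ℝ) : Set (Set ℚ) := {W | ∃ s : Finset ℝ, ↑s ⊆ D ∧ CutSupports s W}

theorem cutAlgebra_mono {D D' : Set ℝ} (h : D ⊆ D') : cutAlgebra D ⊆ cutAlgebra D' :=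
  fun _ ⟨s, hs, hW⟩ => ⟨s, hs.trans h, hW⟩

theorem ratCut_mem_cutAlgebra {D : Set ℝ} {y : ℝ} (hy : y ∈ D) : ratCut y ∈ cutAlgebra D :=
  ⟨{y}, by simpa using hy, fun _ _ h => h y (Finset.mem_singleton_self y)⟩

theorem empty_mem_cutAlgebra (D : Set ℝ) : ∅ ∈ cutAlgebra D :=
  ⟨∅, by simp, fun _ _ _ => Iff.rfl⟩

theorem compl_mem_cutAlgebra {D : Set ℝ} {W : Set ℚ} (h : W ∈ cutAlgebra D) :
    Wᶜ ∈ cutAlgebra D := by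
  obtain ⟨s, hs, hW⟩ := h
  exact ⟨s, hs, fun p q hpq => not_congr (hW p q hpq)⟩

theorem inter_mem_cutAlgebra {D : Set ℝ} {W W' : Set ℚ} (h : W ∈ cutAlgebra D)
    (h' : W' ∈ cutAlgebra D) : W ∩ W' ∈ cutAlgebra D := by
  obtain ⟨s, hs, hW⟩ := h
  obtain ⟨s', hs', hW'⟩ := h'
  refine ⟨s ∪ s', by simp [hs, hs'], fun p q hpq => ?_⟩
  exact and_congr (hW.mono Finset.subset_union_left p q hpq)
    (hW'.mono Finset.subset_union_right p q hpq)

theorem union_mem_cutAlgebra {D : Set ℝ} {W W' : Set ℚ} (h : W ∈ cutAlgebra D)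
    (h' : W' ∈ cutAlgebra D) : W ∪ W' ∈ cutAlgebra D := by
  rw [← compl_compl (W ∪ W'), Set.compl_union]
  exact compl_mem_cutAlgebra
    (inter_mem_cutAlgebra (compl_mem_cutAlgebra h) (compl_mem_cutAlgebra h'))

open Classical in
theorem mk_cutAlgebra_le (D : Set ℝ) [Infinite D] :
    Cardinal.mk (cutAlgebra D) ≤ Cardinal.mk D := by
  let φ : Finset D × Finset (Finset D) → Set ℚ :=
    fun c => {q : ℚ | c.1.filter (fun y : D => (q : ℝ) < y) ∈ c.2}
  have hsub : cutAlgebra D ⊆ Set.range φ := by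
    rintro W ⟨s, hs, hW⟩
    let s' : Finset D := s.subtype (· ∈ D)
    refine ⟨(s', s'.powerset.filter fun u : Finset D =>
      ∃ q ∈ W, s'.filter (fun y : D => (q : ℝ) < y) = u), ?_⟩
    ext q
    simp only [φ, Set.mem_ofPred_eq, Finset.mem_filter, Finset.mem_powerset, Finset.filter_subset,
      true_and]
    refine ⟨fun ⟨p, hp, hpq⟩ => (hW p q fun y hy => ?_).1 hp, fun h => ⟨q, h, rfl⟩⟩
    have := Finset.ext_iff.1 hpq ⟨y, hs hy⟩
    simpa [s', hy] using this
  calc Cardinal.mk (cutAlgebra D) ≤ Cardinal.mk (Set.range φ) := Cardinal.mk_le_mk_of_subset hsub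
    _ ≤ Cardinal.mk (Finset D × Finset (Finset D)) := Cardinal.mk_range_le
    _ = Cardinal.mk D := by simp

/-- The homomorphism from the subsets of `ℚ` to `P(ω)/fin` repeating each rational infinitely
often. -/
noncomputable def ratSetToPowModFin (W : Set ℚ) : PowModFin :=
  ((fun n => ((Denumerable.eqv (ℚ × ℕ)).symm n).1 ∈ W : ℕ → Prop) : PowModFin)

theorem ratSetToPowModFin_injective : Function.Injective ratSetToPowModFin := by
  intro W W' h
  have h' := Filter.Germ.coe_eq.1 h
  ext q
  have hinf : (Set.range fun k : ℕ => Denumerable.eqv (ℚ × ℕ) (q, k)).Infinite :=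
    Set.infinite_range_of_injective fun a b hab => by simpa using hab
  obtain ⟨n, ⟨k, rfl⟩, hn⟩ := (Filter.frequently_cofinite_iff_infinite.2 hinf).and_eventually h'
    |>.exists
  simpa using hn

theorem ratSetToPowModFin_inter (W W' : Set ℚ) :
    ratSetToPowModFin (W ∩ W') = ratSetToPowModFin W ⊓ ratSetToPowModFin W' := rfl

theorem ratSetToPowModFin_union (W W' : Set ℚ) :
    ratSetToPowModFin (W ∪ W') = ratSetToPowModFin W ⊔ ratSetToPowModFin W' := rfl

theorem ratSetToPowModFin_empty : ratSetToPowModFin ∅ = ⊥ := rfl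

theorem ratSetToPowModFin_univ : ratSetToPowModFin Set.univ = ⊤ := rfl

theorem ratSetToPowModFin_compl (W : Set ℚ) :
    ratSetToPowModFin Wᶜ = (ratSetToPowModFin W)ᶜ := by
  refine (IsCompl.compl_eq (IsCompl.of_eq ?_ ?_)).symm
  · rw [← ratSetToPowModFin_inter, Set.inter_compl_self, ratSetToPowModFin_empty]
  · rw [← ratSetToPowModFin_union, Set.union_compl_self, ratSetToPowModFin_univ]

theorem isBoolSubalgebra_image_cutAlgebra (D : Set ℝ) :
    IsBoolSubalgebra (ratSetToPowModFin '' cutAlgebra D) := by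
  refine ⟨⟨∅, empty_mem_cutAlgebra D, ratSetToPowModFin_empty⟩,
    ⟨Set.univ, ?_, ratSetToPowModFin_univ⟩, ?_, ?_, ?_⟩
  · simpa using compl_mem_cutAlgebra (empty_mem_cutAlgebra D)
  · rintro _ ⟨W, hW, rfl⟩ _ ⟨W', hW', rfl⟩
    exact ⟨W ∩ W', inter_mem_cutAlgebra hW hW', ratSetToPowModFin_inter W W'⟩
  · rintro _ ⟨W, hW, rfl⟩ _ ⟨W', hW', rfl⟩
    exact ⟨W ∪ W', union_mem_cutAlgebra hW hW', ratSetToPowModFin_union W W'⟩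
  · rintro _ ⟨W, hW, rfl⟩
    exact ⟨Wᶜ, compl_mem_cutAlgebra hW, ratSetToPowModFin_compl W⟩

/-- An embedding of algebras of cuts induces an order embedding at the level of sets. -/
theorem BAEmbeds.exists_subset_iff {D D' : Set ℝ}
    (h : BAEmbeds (ratSetToPowModFin '' cutAlgebra D) (ratSetToPowModFin '' cutAlgebra D')) :
    ∃ g : Set ℚ → Set ℚ, (∀ W ∈ cutAlgebra D, g W ∈ cutAlgebra D') ∧
      ∀ W ∈ cutAlgebra D, ∀ W' ∈ cutAlgebra D, g W ⊆ g W' ↔ W ⊆ W' := by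
  obtain ⟨f, hmaps, hinj, -, -, hinf, -, -⟩ := h
  have hg : ∀ W : Set ℚ, ∃ W' : Set ℚ, W ∈ cutAlgebra D →
      W' ∈ cutAlgebra D' ∧ ratSetToPowModFin W' = f (ratSetToPowModFin W) := by
    intro W
    by_cases hW : W ∈ cutAlgebra D
    · obtain ⟨W', hW', h⟩ := hmaps ⟨W, hW, rfl⟩
      exact ⟨W', fun _ => ⟨hW', h⟩⟩
    · exact ⟨∅, fun h => absurd h hW⟩
  choose g hg using hg
  refine ⟨g, fun W hW => (hg W hW).1, fun W hW W' hW' => ?_⟩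
  rw [← Set.inter_eq_left, ← Set.inter_eq_left, ← ratSetToPowModFin_injective.eq_iff,
    ratSetToPowModFin_inter, (hg W hW).2, (hg W' hW').2, ← hinf _ ⟨W, hW, rfl⟩ _ ⟨W', hW', rfl⟩,
    ← ratSetToPowModFin_inter,
    hinj.eq_iff ⟨_, inter_mem_cutAlgebra hW hW', rfl⟩ ⟨W, hW, rfl⟩,
    ratSetToPowModFin_injective.eq_iff]

open Classical in
/-- Some finite support of `W`, if there is one. -/
noncomputable def chosenSupport (W : Set ℚ) : Finset ℝ :=
  if h : ∃ s, CutSupports s W then h.choose else ∅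

theorem CutSupports.chosenSupport {s : Finset ℝ} {W : Set ℚ} (h : CutSupports s W) :
    CutSupports (chosenSupport W) W := by
  have h' : ∃ s, CutSupports s W := ⟨s, h⟩
  rw [_root_.chosenSupport, dif_pos h']
  exact h'.choose_spec

/-- The real recovered from the image `W` of its cut under an embedding sending the cut of each
rational `q` to `V q`. -/
noncomputable def realOfCutImage (V : ℚ → Set ℚ) (W : Set ℚ) : ℝ :=
  sInf {r | ∃ q : ℚ, W ⊆ V q ∧ q = r}

/-- The lower approximation of the image of the cut of `x` under an embedding sending the cut of
each rational `q` to `V q`. -/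
def cutImageApprox (V : ℚ → Set ℚ) (x : ℝ) : Set ℚ := {p | ∃ q : ℚ, (q : ℝ) < x ∧ p ∈ V q}

/-- The reals that are predictable from the reals in `X` by means of the codes in `C`. -/
def predictable (C : Set (ℚ → Set ℚ)) (X : Set ℝ) : Set ℝ :=
  Set.range ((↑) : ℚ → ℝ) ∪ X ∪
    (fun c : (ℚ → Set ℚ) × Set ℚ => realOfCutImage c.1 c.2) ''
      (C ×ˢ cutAlgebra (Set.range ((↑) : ℚ → ℝ) ∪ X)) ∪
    ⋃ c ∈ C ×ˢ X, ↑(chosenSupport (cutImageApprox c.1 c.2))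

open Cardinal in
theorem mk_predictable_lt {C : Set (ℚ → Set ℚ)} {X : Set ℝ} (hC : #C < 𝔠) (hX : #X < 𝔠) :
    #(predictable C X) < 𝔠 := by
  have hD : #(Set.range ((↑) : ℚ → ℝ) ∪ X : Set ℝ) < 𝔠 :=
    (mk_union_le _ _).trans_lt
      (add_lt_of_lt aleph0_le_continuum
        (((Set.countable_range _).le_aleph0).trans_lt aleph0_lt_continuum) hX)
  have : Infinite (Set.range ((↑) : ℚ → ℝ) ∪ X : Set ℝ) :=
    ((Set.infinite_range_of_injective Rat.cast_injective).mono Set.subset_union_left).to_subtype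
  refine (mk_union_le _ _).trans_lt (add_lt_of_lt aleph0_le_continuum
    ((mk_union_le _ _).trans_lt (add_lt_of_lt aleph0_le_continuum hD ?_)) ?_)
  · refine mk_image_le.trans_lt ?_
    rw [mk_setProd]
    simpa using mul_lt_of_lt aleph0_le_continuum hC ((mk_cutAlgebra_le _).trans_lt hD)
  · refine (mk_biUnion_le _ _).trans_lt (mul_lt_of_lt aleph0_le_continuum ?_ ?_)
    · rw [mk_setProd]
      simpa using mul_lt_of_lt aleph0_le_continuum hC hX
    · refine lt_of_le_of_lt (ciSup_le' fun c => ?_) aleph0_lt_continuum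
      exact (Finset.countable_toSet _).le_aleph0

theorem exists_avoiding_of_mk_lt {ι α : Type} [LinearOrder ι] [WellFoundedLT ι] [Nonempty α]
    (hι : ∀ i : ι, Cardinal.mk (Set.Iio i) < Cardinal.mk α) (bad : ι → Set α → Set α)
    (hbad : ∀ i (X : Set α), Cardinal.mk X < Cardinal.mk α → Cardinal.mk (bad i X) < Cardinal.mk α) :
    ∃ x : ι → α, ∀ i, x i ∉ bad i (x '' Set.Iio i) := by
  let step : ∀ i : ι, (∀ j : ι, j < i → α) → α := fun i prev =>
    Classical.epsilon fun y => y ∉ bad i (Set.range fun j : Set.Iio i => prev j.1 j.2)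
  refine ⟨wellFounded_lt.fix step, fun i => ?_⟩
  rw [WellFounded.fix_eq, Set.image_eq_range]
  refine Classical.epsilon_spec (p := fun y => y ∉ bad i (Set.range fun j : Set.Iio i =>
    (wellFounded_lt (α := ι)).fix step j.1)) ?_
  by_contra! h
  refine lt_irrefl (Cardinal.mk α) ?_
  simpa only [Set.eq_univ_of_forall h, Cardinal.mk_univ] using
    hbad i (Set.range fun j : Set.Iio i => (wellFounded_lt (α := ι)).fix step j.1)
      (Cardinal.mk_range_le.trans_lt (hι i))

/-- The reals that generate the algebra at stage `β`. -/
def stageReals {ι : Type} {J : Type*} [LT J] (π : ι → J) (x : ι → ℝ) (β : J) : Set ℝ :=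
  Set.range ((↑) : ℚ → ℝ) ∪ x '' {i | ¬ π i < β}

open Cardinal in
theorem not_baEmbeds_stageReals {ι : Type} [LinearOrder ι] {J : Type*} [Preorder J]
    (hι : ∀ i : ι, #(Set.Iio i) < 𝔠) (π : ι → J) (hπ : ∀ α, #{i | π i = α} = 𝔠)
    (V : ι → ℚ → Set ℚ) (hV : Function.Surjective V) (x : ι → ℝ)
    (hx : ∀ i, x i ∉ predictable (V '' Set.Iio i) (x '' Set.Iio i)) {α β : J} (hαβ : α < β) :
    ¬ BAEmbeds (ratSetToPowModFin '' cutAlgebra (stageReals π x α))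
      (ratSetToPowModFin '' cutAlgebra (stageReals π x β)) := by
  intro h
  obtain ⟨g, hmaps, hsub⟩ := h.exists_subset_iff
  have hrat : ∀ q : ℚ, ratCut q ∈ cutAlgebra (stageReals π x α) := fun q =>
    ratCut_mem_cutAlgebra (Or.inl ⟨q, rfl⟩)
  have hreal : ∀ i, π i = α → ratCut (x i) ∈ cutAlgebra (stageReals π x α) := fun i hi =>
    ratCut_mem_cutAlgebra (Or.inr ⟨i, by simp [hi], rfl⟩)
  obtain ⟨c, hc⟩ := hV fun q => g (ratCut q)
  have hVc : ∀ q, V c q = g (ratCut q) := fun q => congrFun hc q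
  have hle : ∀ i, π i = α → ∀ q : ℚ, g (ratCut (x i)) ⊆ V c q ↔ x i ≤ q := fun i hi q => by
    rw [hVc, hsub _ (hreal i hi) _ (hrat q), ratCut_subset_iff]
  have hge : ∀ i, π i = α → ∀ q : ℚ, V c q ⊆ g (ratCut (x i)) ↔ q ≤ x i := fun i hi q => by
    rw [hVc, hsub _ (hrat q) _ (hreal i hi), ratCut_subset_iff]
  have hne : ∀ i j, i < j → x i ≠ x j := fun i j hij h =>
    hx j (Or.inl (Or.inl (Or.inr ⟨i, hij, h⟩)))
  have hinj : Function.Injective x := fun i j h => by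
    rcases lt_trichotomy i j with hij | hij | hij
    · exact absurd h (hne i j hij)
    · exact hij
    · exact absurd h.symm (hne j i hij)
  let exc : Set ι := {i | π i = α ∧ cutImageApprox (V c) (x i) ≠ g (ratCut (x i))}
  have happrox : ∀ i, π i = α → cutImageApprox (V c) (x i) ⊆ g (ratCut (x i)) := by
    rintro i hi p ⟨q, hq, hp⟩
    exact (hge i hi q).2 hq.le hp
  have hexc : exc.Countable := by
    have hp : ∀ i : exc, ∃ p, p ∈ g (ratCut (x i)) ∧ p ∉ cutImageApprox (V c) (x i) := fun i =>
      Set.exists_of_ssubset ((happrox i i.2.1).ssubset_of_ne i.2.2)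
    choose p hp hp' using hp
    have hlt : ∀ i j : exc, p i = p j → ¬ x i < x j := fun i j hij hlt => by
      obtain ⟨q, hq, hq'⟩ := exists_rat_btwn hlt
      exact hp' j ⟨q, hq', (hle i i.2.1 q).2 hq.le (hij ▸ hp i)⟩
    have hpinj : Function.Injective p := fun i j hij => by
      rcases lt_trichotomy (x i) (x j) with h | h | h
      · exact absurd h (hlt i j hij)
      · exact Subtype.ext (hinj h)
      · exact absurd h (hlt j i hij.symm)
    exact hpinj.countable
  obtain ⟨i, hi, hci, hGi⟩ : ∃ i, π i = α ∧ c < i ∧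
      cutImageApprox (V c) (x i) = g (ratCut (x i)) := by
    by_contra! hcon
    have hcover : {i | π i = α} ⊆ exc ∪ (Set.Iio c ∪ {c}) := fun i hi => by
      rcases lt_trichotomy i c with h | h | h
      · exact Or.inr (Or.inl h)
      · exact Or.inr (Or.inr h)
      · exact Or.inl ⟨hi, hcon i hi h⟩
    refine (hπ α).not_lt ((mk_le_mk_of_subset hcover).trans_lt ?_)
    refine (mk_union_le _ _).trans_lt (add_lt_of_lt aleph0_le_continuum
      (hexc.le_aleph0.trans_lt aleph0_lt_continuum) ((mk_union_le _ _).trans_lt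
      (add_lt_of_lt aleph0_le_continuum (hι c) ?_)))
    simpa using nat_lt_continuum 1
  obtain ⟨t, ht, htW⟩ := hmaps _ (hreal i hi)
  refine hx i (Or.inl (Or.inr ⟨(V c, g (ratCut (x i))), ⟨⟨c, hci, rfl⟩, ?_⟩, ?_⟩))
  · refine ⟨chosenSupport (g (ratCut (x i))) ∩ t, fun y hy => ?_, htW.chosenSupport.inter htW⟩
    obtain ⟨hy, hyt⟩ := Finset.mem_inter.1 (Finset.mem_coe.1 hy)
    rcases ht hyt with hq | ⟨j, hj, rfl⟩
    · exact Or.inl hq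
    · refine Or.inr ⟨j, ?_, rfl⟩
      rcases lt_trichotomy j i with hji | hji | hji
      · exact hji
      · subst hji
        exact absurd (hi ▸ hαβ) hj
      · refine absurd (Or.inr ?_) (hx j)
        refine Set.mem_biUnion (x := (V c, x i))
          ⟨⟨c, hci.trans hji, rfl⟩, ⟨i, hji, rfl⟩⟩ ?_
        exact Finset.mem_coe.2 (by simpa only [hGi] using hy)
  · have hset : {r : ℝ | ∃ q : ℚ, g (ratCut (x i)) ⊆ V c q ∧ q = r} =
        ((↑) : ℚ → ℝ) '' {q : ℚ | x i ≤ q} := by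
      ext r
      simp only [Set.mem_ofPred_eq, Set.mem_image, hle i hi]
    change sInf _ = x i
    rw [hset]
    refine IsGLB.csInf_eq ⟨?_, fun b hb => ?_⟩ ?_
    · rintro _ ⟨q, hq, rfl⟩
      exact hq
    · by_contra! hlt
      obtain ⟨q, hq, hq'⟩ := exists_rat_btwn hlt
      exact absurd (hb ⟨q, hq.le, rfl⟩) hq'.not_ge
    · obtain ⟨q, hq⟩ := exists_rat_gt (x i)
      exact ⟨q, q, hq.le, rfl⟩

open Cardinal in
theorem exists_map_mk_fiber_eq (ι : Type) (J : Type*) (hι : #ι = 𝔠) (hJ : #J = 𝔠) :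
    ∃ π : ι → J, ∀ α, #{i | π i = α} = 𝔠 := by
  obtain ⟨e⟩ : Nonempty (ι ≃ ι × ι) := Cardinal.eq.1 (by simp [hι])
  obtain ⟨e'⟩ : Nonempty (ι ≃ J) := Cardinal.lift_mk_eq'.1 (by simp [hι, hJ])
  refine ⟨fun i => e' (e i).1, fun α => ?_⟩
  rw [← hι]
  let toFiber : ι → {i | e' (e i).1 = α} := fun j => ⟨e.symm (e'.symm α, j), by simp⟩
  refine (Cardinal.mk_congr (Equiv.ofBijective toFiber ⟨fun j k hjk => ?_, ?_⟩)).symm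
  · simpa [toFiber] using hjk
  · rintro ⟨i, rfl⟩
    exact ⟨(e i).2, by simp [toFiber]⟩

/-- There is a transfinite sequence `(B_α)_{α < 𝔠}` of Boolean subalgebras of
`P(ω)/fin`, indexed by the ordinals below the continuum, such that for all
`α < β < 𝔠`: `B_β` is a subalgebra of `B_α`, and there is no Boolean algebra
embedding of `B_α` into `B_β`. -/
theorem continuum_chain_of_subalgebras_of_PowModFin :
    ∃ B : {o : Ordinal // o < Cardinal.continuum.ord} → Set PowModFin,
      (∀ α, IsBoolSubalgebra (B α)) ∧
      (∀ α β : {o : Ordinal // o < Cardinal.continuum.ord},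
        (α : Ordinal) < (β : Ordinal) → B β ⊆ B α ∧ ¬ BAEmbeds (B α) (B β)) := by
  let ι : Type := (Cardinal.continuum.{0}).ord.ToType
  have hι : Cardinal.mk ι = Cardinal.continuum := by simp [ι]
  have hIio : ∀ i : ι, Cardinal.mk (Set.Iio i) < Cardinal.continuum := fun i => by
    simpa [hι] using Cardinal.mk_Iio_lt i (by simp [ι])
  have hJ : Cardinal.mk {o : Ordinal // o < Cardinal.continuum.ord} = Cardinal.continuum :=
    (Cardinal.mk_Iio_ordinal Cardinal.continuum.ord).trans (by simp)
  obtain ⟨π, hπ⟩ := exists_map_mk_fiber_eq ι _ hι hJ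
  obtain ⟨e⟩ : Nonempty (ι ≃ (ℚ → Set ℚ)) := Cardinal.eq.1 (by
    rw [hι, ← Cardinal.power_def]
    simp)
  obtain ⟨x, hx⟩ := exists_avoiding_of_mk_lt (ι := ι) (α := ℝ)
    (fun i => by simpa [Cardinal.mk_real] using hIio i)
    (fun i X => predictable (e '' Set.Iio i) X) (fun i X hX => by
      rw [Cardinal.mk_real] at hX ⊢
      exact mk_predictable_lt (Cardinal.mk_image_le.trans_lt (hIio i)) hX)
  refine ⟨fun α => ratSetToPowModFin '' cutAlgebra (stageReals π x α),
    fun α => isBoolSubalgebra_image_cutAlgebra _, fun α β hαβ => ⟨?_, ?_⟩⟩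
  · refine Set.image_mono (cutAlgebra_mono (Set.union_subset_union_right _ (Set.image_mono ?_)))
    exact fun i hi h => hi (h.trans hαβ)
  · exact not_baEmbeds_stageReals hIio π hπ e e.surjective x hx hαβ
end

section
/- There exist a family (K_X), indexed by the subsets X of ℝ, of nonempty separable zero-dimensional compact Hausdorff topological spaces, together with continuous surjections h_{X,Y} : K_X → K_Y for all X ⊆ Y ⊆ ℝ, such that h_{X,X} is the identity, h_{X,Z} = h_{Y,Z} ∘ h_{X,Y} whenever X ⊆ Y ⊆ Z ⊆ ℝ, and such that whenever X ⊄ Y there is no continuous surjection from K_X onto K_Y. -/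
open Set Cardinal

/-- `S` is a union of cells of the partition of `ℚ` induced by the cuts at the points of `T`. -/
def CutDetermined (T : Set ℝ) (S : Set ℚ) : Prop :=
  ∀ m n : ℚ, (∀ t ∈ T, ((m : ℝ) < t ↔ (n : ℝ) < t)) → (m ∈ S ↔ n ∈ S)

theorem CutDetermined.mono {T T' : Set ℝ} {S : Set ℚ} (h : CutDetermined T S) (hT : T ⊆ T') :
    CutDetermined T' S :=
  fun m n hmn => h m n fun t ht => hmn t (hT ht)

theorem CutDetermined.eq_of_insert {T : Set ℝ} {S : Set ℚ} {p p' : ℝ}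
    (hp : CutDetermined (insert p T) S) (hp' : CutDetermined (insert p' T) S)
    (hT : ¬ CutDetermined T S) : p = p' := by
  wlog hlt : p < p' generalizing p p'
  · rcases lt_trichotomy p p' with h | h | h
    · exact this hp hp' h
    · exact h
    · exact (this hp' hp h).symm
  exfalso
  obtain ⟨k, hpk, hkp'⟩ := exists_rat_btwn hlt
  refine hT fun m n hmn => ?_
  wlog hle : m ≤ n generalizing m n
  · exact (this n m (fun t ht => (hmn t ht).symm) (le_of_not_ge hle)).symm
  have hle' : (m : ℝ) ≤ n := by exact_mod_cast hle
  have key : ∀ q : ℝ, CutDetermined (insert q T) S → ((m : ℝ) < q ↔ (n : ℝ) < q) →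
      (m ∈ S ↔ n ∈ S) := fun q hq h => hq m n (by
    rintro t (rfl | ht)
    · exact h
    · exact hmn t ht)
  by_cases h1 : (m : ℝ) < p ↔ (n : ℝ) < p
  · exact key p hp h1
  by_cases h2 : (m : ℝ) < p' ↔ (n : ℝ) < p'
  · exact key p' hp' h2
  have hmp : (m : ℝ) < p := by
    by_contra h
    exact h1 ⟨fun h' => absurd h' h, fun h' => absurd (hle'.trans_lt h') h⟩
  have hnp : p' ≤ (n : ℝ) := by
    by_contra h
    exact h2 ⟨fun _ => not_le.1 h, fun h' => hle'.trans_lt h'⟩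
  have hmk : m ∈ S ↔ k ∈ S := hp' m k (by
    rintro t (rfl | ht)
    · exact ⟨fun _ => hkp', fun _ => hmp.trans hlt⟩
    · exact ⟨fun h => by linarith [(hmn t ht).1 h], fun h => by linarith⟩)
  have hkn : k ∈ S ↔ n ∈ S := hp k n (by
    rintro t (rfl | ht)
    · exact ⟨fun h => by linarith, fun h => by linarith⟩
    · exact ⟨fun h => (hmn t ht).1 (by linarith), fun h => by linarith⟩)
  exact hmk.trans hkn

theorem finite_setOf_cutDetermined {T : Set ℝ} (hT : T.Finite) :
    {S : Set ℚ | CutDetermined T S}.Finite := by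
  have := hT.to_subtype
  let c : ℚ → Set T := fun q => {t | (q : ℝ) < t}
  refine (finite_range fun G : Set (Set T) => c ⁻¹' G).subset fun S hS => ⟨c '' S, ?_⟩
  ext n
  constructor
  · rintro ⟨m, hm, hmn⟩
    refine (hS m n fun t ht => ?_).1 hm
    exact Set.ext_iff.1 hmn ⟨t, ht⟩
  · exact fun hn => ⟨n, hn, rfl⟩

theorem mk_iUnion_le_of_forall_le {ι α : Type} {f : ι → Set α} {κ : Cardinal.{0}} (hκ : ℵ₀ ≤ κ)
    (hι : #ι ≤ κ) (hf : ∀ i, #(f i) ≤ κ) : #(⋃ i, f i) ≤ κ :=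
  (mk_iUnion_le f).trans <| (mul_le_mul' hι (ciSup_le' hf)).trans (mul_eq_self hκ).le

theorem mk_finset_le_of_le {α : Type} {κ : Cardinal.{0}} (hκ : ℵ₀ ≤ κ) (hα : #α ≤ κ) :
    #(Finset α) ≤ κ := by
  rcases finite_or_infinite α with h | h
  · exact (lt_aleph0_of_finite _).le.trans hκ
  · exact (mk_finset_of_infinite α).le.trans hα

/-- The points that must be avoided when a sequence of points whose previous values form `Q` is
extended, in order to diagonalize against the maps `s γ`, `γ ∈ Γ`. -/
def forbidden {I : Type} (s : I → ℝ → Set ℚ) (Γ : Set I) (Q : Set ℝ) : Set ℝ :=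
  Q ∪
    ((⋃ γ : Γ, ⋃ T : Finset Q, {a | (∀ a', s γ a = s γ a' → a = a') ∧
      CutDetermined (Subtype.val '' (T : Set Q)) (s γ a)}) ∪
    ⋃ γ : Γ, ⋃ T : Finset Q, ⋃ b : Q, {a |
      CutDetermined (insert a (Subtype.val '' (T : Set Q))) (s γ b) ∧
      ¬ CutDetermined (Subtype.val '' (T : Set Q)) (s γ b)})

theorem mk_forbidden_le {I : Type} (s : I → ℝ → Set ℚ) {Γ : Set I} {Q : Set ℝ}
    {κ : Cardinal.{0}} (hκ : ℵ₀ ≤ κ) (hΓ : #Γ ≤ κ) (hQ : #Q ≤ κ) : #(forbidden s Γ Q) ≤ κ := by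
  have hadd {A B : Set ℝ} (hA : #A ≤ κ) (hB : #B ≤ κ) : #(A ∪ B : Set ℝ) ≤ κ :=
    (mk_union_le A B).trans ((add_le_add hA hB).trans (add_eq_self hκ).le)
  have hfin := mk_finset_le_of_le hκ hQ
  refine hadd hQ (hadd ?_ ?_)
  · refine mk_iUnion_le_of_forall_le hκ hΓ fun γ => mk_iUnion_le_of_forall_le hκ hfin fun T => ?_
    refine (Set.Countable.le_aleph0 (Set.Finite.countable ?_)).trans hκ
    refine Set.Finite.of_finite_image (f := s γ)
      ((finite_setOf_cutDetermined (T.finite_toSet.image Subtype.val)).subset ?_) ?_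
    · rintro _ ⟨a, ha, rfl⟩
      exact ha.2
    · exact fun a ha a' _ h => ha.1 a' h
  · refine mk_iUnion_le_of_forall_le hκ hΓ fun γ => mk_iUnion_le_of_forall_le hκ hfin fun T =>
      mk_iUnion_le_of_forall_le hκ hQ fun b => ?_
    refine (Set.Countable.le_aleph0 (Set.Subsingleton.countable ?_)).trans hκ
    exact fun a ha a' ha' => ha.1.eq_of_insert ha'.1 ha.2

theorem exists_injective_not_cutDetermined {I : Type} [LinearOrder I] [WellFoundedLT I]
    (hI : ∀ i : I, #(Iio i) < 𝔠) (s : I → ℝ → Set ℚ) :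
    ∃ p : I → ℝ, Function.Injective p ∧ ∀ γ β, γ < β →
      (∀ a, s γ (p β) = s γ a → p β = a) →
      ∀ T : Finset I, β ∉ T → ¬ CutDetermined (p '' T) (s γ (p β)) := by
  have hex : ∀ (i : I) (g : (j : I) → j < i → ℝ),
      ∃ a, a ∉ forbidden s (Iio i) (range fun j : Iio i => g j j.2) := by
    intro i g
    by_contra! h
    have hlt : max ℵ₀ #(Iio i) < 𝔠 := max_lt aleph0_lt_continuum (hI i)
    have hle := mk_forbidden_le s (Γ := Iio i) (Q := range fun j : Iio i => g j j.2)
      (le_max_left _ _) (le_max_right _ _) (mk_range_le.trans (le_max_right _ _))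
    rw [eq_univ_of_forall h, mk_univ_real] at hle
    exact hlt.not_ge hle
  choose F hF using hex
  let p : I → ℝ := wellFounded_lt.fix F
  have hp : ∀ i, p i ∉ forbidden s (Iio i) (p '' Iio i) := by
    intro i
    have := hF i fun j _ => p j
    rw [image_eq_range]
    rwa [show p i = F i fun j _ => p j from wellFounded_lt.fix_eq F i]
  have hval : ∀ {i : I} {T : Finset I}, (∀ j ∈ T, j < i) →
      ∃ T' : Finset (p '' Iio i), Subtype.val '' (T' : Set (p '' Iio i)) = p '' T := by
    intro i T hT
    have hsub : p '' T ⊆ p '' Iio i := image_mono fun j hj => hT j hj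
    have hfin : (Subtype.val ⁻¹' (p '' T) : Set (p '' Iio i)).Finite :=
      (T.finite_toSet.image p).preimage Subtype.val_injective.injOn
    refine ⟨hfin.toFinset, ?_⟩
    rw [hfin.coe_toFinset, Subtype.image_preimage_coe, inter_eq_right.2 hsub]
  have hinj : ∀ i j, i < j → p i ≠ p j := fun i j hij h =>
    hp j (Or.inl ⟨i, hij, h⟩)
  refine ⟨p, fun i j h => ?_, fun γ β hγβ hβ T => ?_⟩
  · rcases lt_trichotomy i j with hij | hij | hij
    · exact absurd h (hinj i j hij)
    · exact hij
    · exact absurd h.symm (hinj j i hij)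
  have hbelow : ∀ T : Finset I, (∀ j ∈ T, j < β) → ¬ CutDetermined (p '' T) (s γ (p β)) := by
    intro T hT hdet
    obtain ⟨T', hT'⟩ := hval hT
    refine hp β (Or.inr (Or.inl (mem_iUnion₂.2 ⟨⟨γ, hγβ⟩, T', hβ, ?_⟩)))
    rwa [hT']
  induction T using Finset.induction_on_max with
  | empty => exact fun _ => hbelow ∅ (by simp)
  | insert α T hT ih =>
    intro hmem hdet
    rw [Finset.mem_insert, not_or] at hmem
    rcases lt_or_gt_of_ne hmem.1 with hlt | hlt
    · obtain ⟨T', hT'⟩ := hval hT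
      refine hp α (Or.inr (Or.inr (mem_iUnion.2 ⟨⟨γ, hγβ.trans hlt⟩, mem_iUnion₂.2
        ⟨T', ⟨p β, β, hlt, rfl⟩, ?_, ?_⟩⟩)))
      · rwa [hT', ← image_insert_eq, ← Finset.coe_insert]
      · rw [hT']
        exact ih hmem.2
    · refine hbelow (insert α T) (fun j hj => ?_) hdet
      rcases Finset.mem_insert.1 hj with rfl | hj
      · exact hlt
      · exact (hT j hj).trans hlt

theorem mk_orderHom_real_bool_le : #(ℝ →o Bool) ≤ 𝔠 := by
  let code : (ℝ →o Bool) → (ℚ → Bool) × ℝ × Bool := fun x =>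
    (fun q => x q, sInf {a | x a = true}, x (sInf {a | x a = true}))
  have aux : ∀ x y : ℝ →o Bool, code x = code y → ∀ a, x a = true → y a = true := by
    intro x y hxy a hx
    by_contra hy
    have hq : ∀ q : ℚ, x q = y q := fun q => congrFun (congrArg Prod.fst hxy) q
    have hs : sInf {a | x a = true} = sInf {a | y a = true} :=
      congrArg (fun z => z.2.1) hxy
    have hv : x (sInf {a | x a = true}) = y (sInf {a | y a = true}) :=
      congrArg (fun z => z.2.2) hxy
    have hleast : IsLeast {a | x a = true} a := by
      refine ⟨hx, fun t ht => ?_⟩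
      by_contra! hta
      obtain ⟨q, htq, hqa⟩ := exists_rat_btwn hta
      have h1 : x q = true :=
        top_le_iff.1 ((show true = x t from Eq.symm ht).le.trans (x.mono htq.le))
      exact hy (top_le_iff.1 ((show true = y q from (hq q ▸ h1).symm).le.trans (y.mono hqa.le)))
    rw [← hs, hleast.csInf_eq] at hv
    exact hy (hv ▸ hx)
  have hinj : Function.Injective code := fun x y h => by
    ext a
    exact Bool.eq_iff_iff.2 ⟨aux x y h a, aux y x h.symm a⟩
  refine (mk_le_of_injective hinj).trans ?_
  simp [mk_real]

/-- The set of rationals whose value at `a` is `true`. -/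
def preCut (φ : ℚ → ℝ →o Bool) (a : ℝ) : Set ℚ := {n | φ n a = true}

theorem preCut_mono (φ : ℚ → ℝ →o Bool) : Monotone (preCut φ) := fun _ _ hab n hn =>
  top_le_iff.1 ((show true = _ from Eq.symm hn).le.trans ((φ n).mono hab))

theorem countable_preCut_not_unique {φ : ℚ → ℝ →o Bool} {E : Set ℝ} (hE : InjOn (preCut φ) E) :
    {a ∈ E | ¬ ∀ a', preCut φ a = preCut φ a' → a = a'}.Countable := by
  refine Set.countable_of_injective_of_countable_image (f := preCut φ)
    (hE.mono fun a ha => ha.1) ?_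
  refine (countable_range fun q : ℚ => preCut φ q).mono ?_
  rintro _ ⟨a, ⟨-, ha⟩, rfl⟩
  push Not at ha
  obtain ⟨a', h, hne⟩ := ha
  rcases lt_or_gt_of_ne hne with hlt | hlt
  · obtain ⟨q, h1, h2⟩ := exists_rat_btwn hlt
    exact ⟨q, (h ▸ preCut_mono φ h2.le).antisymm (preCut_mono φ h1.le)⟩
  · obtain ⟨q, h1, h2⟩ := exists_rat_btwn hlt
    exact ⟨q, (preCut_mono φ h2.le).antisymm (h ▸ preCut_mono φ h1.le)⟩

/-- The rational `q`, as a point of the Cantor cube, recorded by its position with respect to the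
cuts in `E`. -/
noncomputable def cutPoint (E : Set ℝ) (q : ℚ) : E → Bool := fun a => decide ((q : ℝ) < a)

/-- The Stone space of the algebra of subsets of `ℚ` generated by the cuts at the points of `E`. -/
abbrev CutSpace (E : Set ℝ) : Type := closure (range (cutPoint E))

namespace CutSpace

/-- The canonical map from the rationals to the cut space. -/
noncomputable def ofRat (E : Set ℝ) (q : ℚ) : CutSpace E :=
  ⟨cutPoint E q, subset_closure (mem_range_self q)⟩

theorem denseRange_ofRat (E : Set ℝ) : DenseRange (ofRat E) := by
  intro x
  rw [closure_subtype, ← range_comp]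
  exact x.2

instance (E : Set ℝ) : CompactSpace (CutSpace E) :=
  isCompact_iff_compactSpace.1 isClosed_closure.isCompact

instance (E : Set ℝ) : TopologicalSpace.SeparableSpace (CutSpace E) :=
  ⟨range (ofRat E), countable_range _, denseRange_ofRat E⟩

theorem monotone {E : Set ℝ} (x : CutSpace E) : Monotone x.1 := by
  have : OrderClosedTopology Bool := ⟨isClosed_discrete _⟩
  refine closure_minimal ?_ isClosed_monotone x.2
  rintro _ ⟨q, rfl⟩ a b hab
  simp only [cutPoint, Bool.le_iff_imp, decide_eq_true_eq]
  exact fun h => h.trans_le hab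

/-- The map of cut spaces forgetting some of the cuts. -/
def restrict {E F : Set ℝ} (h : E ⊆ F) (x : CutSpace F) : CutSpace E :=
  ⟨fun a => x.1 (inclusion h a), by
    have hc : Continuous fun (y : F → Bool) (a : E) => y (inclusion h a) := by fun_prop
    refine closure_mono ?_ (image_closure_subset_closure_image hc ⟨x.1, x.2, rfl⟩)
    rintro _ ⟨_, ⟨q, rfl⟩, rfl⟩
    exact ⟨q, rfl⟩⟩

theorem continuous_restrict {E F : Set ℝ} (h : E ⊆ F) : Continuous (restrict h) :=
  continuous_induced_rng.2 <| continuous_pi fun a =>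
    (continuous_apply (inclusion h a)).comp continuous_subtype_val

theorem surjective_restrict {E F : Set ℝ} (h : E ⊆ F) : Function.Surjective (restrict h) := by
  have hd : DenseRange (restrict h) := by
    refine (denseRange_ofRat E).mono ?_
    rintro _ ⟨q, rfl⟩
    exact ⟨ofRat F q, rfl⟩
  rw [← range_eq_univ, ← (isCompact_range (continuous_restrict h)).isClosed.closure_eq]
  exact hd.closure_range

/-- A continuous two-valued function on a cut space depends on finitely many cuts. -/
theorem exists_finset_of_continuous {F : Set ℝ} {g : CutSpace F → Bool} (hg : Continuous g) :
    ∃ T : Finset F, ∀ x y : CutSpace F, (∀ b ∈ T, x.1 b = y.1 b) → g x = g y := by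
  have hloc : ∀ x : CutSpace F, ∃ T : Finset F, ∀ y : CutSpace F,
      (∀ b ∈ T, y.1 b = x.1 b) → g y = g x := by
    intro x
    obtain ⟨u, hu, hgu⟩ := isOpen_induced_iff.1 ((isOpen_discrete {g x}).preimage hg)
    have hxu : x.1 ∈ u := by
      change x ∈ Subtype.val ⁻¹' u
      rw [hgu]
      rfl
    obtain ⟨T, v, hv, hvu⟩ := isOpen_pi_iff.1 hu x.1 hxu
    refine ⟨T, fun y hy => ?_⟩
    have hyu : y ∈ Subtype.val ⁻¹' u := hvu fun b hb => by
      rw [hy b hb]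
      exact (hv b hb).2
    rw [hgu] at hyu
    exact hyu
  choose T hT using hloc
  have hopen : ∀ x : CutSpace F, IsOpen {y : CutSpace F | ∀ b ∈ T x, y.1 b = x.1 b} := by
    intro x
    have : {y : CutSpace F | ∀ b ∈ T x, y.1 b = x.1 b} =
        ⋂ b ∈ T x, (fun y : CutSpace F => y.1 b) ⁻¹' {x.1 b} := by
      ext y
      simp
    rw [this]
    exact isOpen_biInter_finset fun b _ => (isOpen_discrete _).preimage
      ((continuous_apply b).comp continuous_subtype_val)
  obtain ⟨s, hs⟩ := isCompact_univ.elim_finite_subcover _ hopen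
    fun x _ => mem_iUnion.2 ⟨x, fun _ _ => rfl⟩
  classical
  refine ⟨s.biUnion T, fun x y hxy => ?_⟩
  obtain ⟨z, hz, hxz⟩ := mem_iUnion₂.1 (hs (mem_univ x))
  rw [hT z x hxz, hT z y fun b hb => ?_]
  rw [← hxy b (Finset.mem_biUnion.2 ⟨z, hz, hb⟩)]
  exact hxz b hb

/-- The extension of a point of a cut space to a monotone function on `ℝ`. -/
noncomputable def extend {E : Set ℝ} (x : CutSpace E) : ℝ →o Bool where
  toFun a := by
    classical
    exact decide (∃ b : E, (b : ℝ) ≤ a ∧ x.1 b = true)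
  monotone' a a' h := by
    simp only [Bool.le_iff_imp, decide_eq_true_eq]
    exact fun ⟨b, hb, hx⟩ => ⟨b, hb.trans h, hx⟩

theorem extend_apply {E : Set ℝ} (x : CutSpace E) (a : E) : x.extend a = x.1 a := by
  classical
  rw [Bool.eq_iff_iff]
  refine decide_eq_true_iff.trans ⟨fun ⟨b, hb, hx⟩ => ?_, fun h => ⟨a, le_rfl, h⟩⟩
  exact Bool.le_iff_imp.1 (x.monotone (show b ≤ a from hb)) hx

theorem exists_preCut_of_surjective {E F : Set ℝ} {f : CutSpace F → CutSpace E}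
    (hf : Continuous f) (hsurj : Function.Surjective f) :
    ∃ φ : ℚ → ℝ →o Bool, InjOn (preCut φ) E ∧
      ∀ a ∈ E, ∃ T : Finset F, CutDetermined (Subtype.val '' (T : Set F)) (preCut φ a) := by
  have hmem : ∀ (a : E) (n : ℚ),
      n ∈ preCut (fun n => (f (ofRat F n)).extend) a ↔ (f (ofRat F n)).1 a = true := by
    intro a n
    rw [← extend_apply]
    rfl
  have hcoord : ∀ a : E, Continuous fun z => (f z).1 a := fun a =>
    (continuous_apply a).comp (continuous_subtype_val.comp hf)
  refine ⟨fun n => (f (ofRat F n)).extend, ?_, ?_⟩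
  · have hne : ∀ a b : E, (a : ℝ) < b → preCut (fun n => (f (ofRat F n)).extend) a ≠
        preCut (fun n => (f (ofRat F n)).extend) b := by
      intro a b hab h
      have heq : (fun z => (f z).1 a) = fun z => (f z).1 b := by
        refine (denseRange_ofRat F).equalizer (hcoord a) (hcoord b) (funext fun n => ?_)
        exact Bool.eq_iff_iff.2 ((hmem a n).symm.trans ((Set.ext_iff.1 h n).trans (hmem b n)))
      obtain ⟨q, haq, hqb⟩ := exists_rat_btwn hab
      obtain ⟨z, hz⟩ := hsurj (ofRat E q)
      have := congrFun heq z
      simp only [hz, ofRat, cutPoint, hqb, haq.not_gt] at this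
      simp at this
    intro a ha b hb h
    rcases lt_trichotomy a b with hab | hab | hab
    · exact absurd h (hne ⟨a, ha⟩ ⟨b, hb⟩ hab)
    · exact hab
    · exact absurd h.symm (hne ⟨b, hb⟩ ⟨a, ha⟩ hab)
  · intro a ha
    obtain ⟨T, hT⟩ := exists_finset_of_continuous (hcoord ⟨a, ha⟩)
    refine ⟨T, fun m n hmn => ?_⟩
    rw [hmem ⟨a, ha⟩, hmem ⟨a, ha⟩, hT (ofRat F m) (ofRat F n) fun b hb => ?_]
    exact decide_eq_decide.2 (hmn b ⟨b, hb, rfl⟩)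

end CutSpace

/-- There is an injective family of reals, indexed by the plane, such that the cut space of a
subfamily avoiding some vertical line does not map onto the cut space of a subfamily containing
that line. -/
theorem exists_injective_not_surjective :
    ∃ p : ℝ × ℝ → ℝ, Function.Injective p ∧ ∀ (A B : Set (ℝ × ℝ)) (x : ℝ),
      (∀ y, (x, y) ∉ A) → (∀ y, (x, y) ∈ B) →
      ¬ ∃ f : CutSpace (p '' A) → CutSpace (p '' B), Continuous f ∧ Function.Surjective f := by
  let I := (𝔠).ord.ToType
  have hI : #I = 𝔠 := mk_ord_toType _
  have hIio : ∀ i : I, #(Iio i) < 𝔠 := fun i => (mk_Iio_lt i (by simp [I])).trans_eq hI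
  have hfun : #(ℚ → ℝ →o Bool) ≤ #I := by
    rw [hI]
    calc #(ℚ → ℝ →o Bool) = #(ℝ →o Bool) ^ #ℚ := (power_def _ _).symm
      _ ≤ 𝔠 ^ ℵ₀ := by
        rw [mk_eq_aleph0 ℚ]
        exact power_le_power_right mk_orderHom_real_bool_le
      _ = 𝔠 := continuum_power_aleph0
  obtain ⟨e⟩ : Nonempty ((ℚ → ℝ →o Bool) ↪ I) := hfun
  obtain ⟨π⟩ : Nonempty (ℝ × ℝ ≃ I) := by
    rw [← Cardinal.eq, hI]
    simp [mk_real]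
  let Φ : I → ℚ → ℝ →o Bool := Function.invFun e
  have hΦ : Function.Surjective Φ := Function.invFun_surjective e.injective
  obtain ⟨p, hp, hdiag⟩ := exists_injective_not_cutDetermined hIio fun γ => preCut (Φ γ)
  refine ⟨p ∘ π, hp.comp π.injective, fun A B x hA hB => ?_⟩
  rintro ⟨f, hf, hsurj⟩
  obtain ⟨φ, hinj, hdet⟩ := CutSpace.exists_preCut_of_surjective hf hsurj
  obtain ⟨γ, rfl⟩ := hΦ φ
  have hcount := countable_preCut_not_unique hinj
  set C := {a ∈ p ∘ π '' B | ¬ ∀ a', preCut (Φ γ) a = preCut (Φ γ) a' → a = a'}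
  have hcover : range (fun y : ℝ => π (x, y)) ⊆ Iic γ ∪ p ⁻¹' C := by
    rintro _ ⟨y, rfl⟩
    by_contra hy
    rw [mem_union, not_or, mem_Iic, not_le] at hy
    have hB' : p (π (x, y)) ∈ p ∘ π '' B := ⟨(x, y), hB y, rfl⟩
    have huniq : ∀ a, preCut (Φ γ) (p (π (x, y))) = preCut (Φ γ) a → p (π (x, y)) = a := by
      by_contra h
      exact hy.2 ⟨hB', h⟩
    obtain ⟨T, hT⟩ := hdet _ hB'
    have hfin : (p ⁻¹' (Subtype.val '' (T : Set (p ∘ π '' A)))).Finite :=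
      (T.finite_toSet.image _).preimage hp.injOn
    refine hdiag γ (π (x, y)) hy.1 huniq hfin.toFinset ?_ (hT.mono ?_)
    · rw [hfin.mem_toFinset]
      rintro ⟨⟨_, z, hz, rfl⟩, -, h⟩
      have hzx : z = (x, y) := π.injective (hp h)
      exact hA y (hzx ▸ hz)
    · rw [hfin.coe_toFinset]
      rintro _ ⟨⟨_, z, hz, rfl⟩, ht, rfl⟩
      exact ⟨π z, ⟨_, ht, rfl⟩, rfl⟩
  have hlt : #(Iic γ ∪ p ⁻¹' C : Set I) < 𝔠 := by
    refine (mk_union_le _ _).trans_lt (add_lt_of_lt aleph0_le_continuum ?_ ?_)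
    · rw [← Iio_insert]
      refine (mk_insert_le).trans_lt (add_lt_of_lt aleph0_le_continuum (hIio γ) ?_)
      exact one_lt_aleph0.trans aleph0_lt_continuum
    · exact (hcount.preimage hp).le_aleph0.trans_lt aleph0_lt_continuum
  refine hlt.not_ge ?_
  have hsection : Function.Injective fun y : ℝ => π (x, y) :=
    π.injective.comp (Prod.mk_right_injective x)
  calc 𝔠 = #(range fun y : ℝ => π (x, y)) := by rw [mk_range_eq _ hsection, mk_real]
    _ ≤ _ := mk_le_mk_of_subset hcover

/-- There exist a family `(K_X)`, indexed by the subsets `X` of `ℝ`, of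
nonempty separable zero-dimensional compact Hausdorff spaces, together with
continuous surjections `h_{X,Y} : K_X → K_Y` for all `X ⊆ Y`, such that
`h_{X,X} = id`, `h_{X,Z} = h_{Y,Z} ∘ h_{X,Y}` for `X ⊆ Y ⊆ Z`, and whenever
`X ⊄ Y` there is no continuous surjection from `K_X` onto `K_Y`. -/
theorem exists_spaces_family :
    ∃ (K : Set ℝ → Type) (τ : ∀ X, TopologicalSpace (K X))
      (h : ∀ X Y : Set ℝ, X ⊆ Y → K X → K Y),
      (∀ X, Nonempty (K X)) ∧
      (∀ X, @CompactSpace (K X) (τ X)) ∧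
      (∀ X, @T2Space (K X) (τ X)) ∧
      (∀ X, @TopologicalSpace.SeparableSpace (K X) (τ X)) ∧
      (∀ X, @TopologicalSpace.IsTopologicalBasis (K X) (τ X)
        {s : Set (K X) | @IsClopen (K X) (τ X) s}) ∧
      (∀ X Y (hXY : X ⊆ Y),
        @Continuous _ _ (τ X) (τ Y) (h X Y hXY) ∧ Function.Surjective (h X Y hXY)) ∧
      (∀ X (hXX : X ⊆ X), h X X hXX = id) ∧
      (∀ X Y Z (hXY : X ⊆ Y) (hYZ : Y ⊆ Z),
        h X Z (hXY.trans hYZ) = h Y Z hYZ ∘ h X Y hXY) ∧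
      (∀ X Y : Set ℝ, ¬ X ⊆ Y →
        ¬ ∃ f : K X → K Y, @Continuous _ _ (τ X) (τ Y) f ∧ Function.Surjective f) := by
  obtain ⟨p, -, hns⟩ := exists_injective_not_surjective
  have hmono : ∀ X Y : Set ℝ, X ⊆ Y → p '' (Prod.fst ⁻¹' Yᶜ) ⊆ p '' (Prod.fst ⁻¹' Xᶜ) :=
    fun X Y h => image_mono (preimage_mono (compl_subset_compl.2 h))
  refine ⟨fun X => CutSpace (p '' (Prod.fst ⁻¹' Xᶜ)), fun X => inferInstance,
    fun X Y h => CutSpace.restrict (hmono X Y h), fun X => ⟨CutSpace.ofRat _ 0⟩,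
    fun X => inferInstance, fun X => inferInstance, fun X => inferInstance,
    fun X => isTopologicalBasis_isClopen,
    fun X Y h => ⟨CutSpace.continuous_restrict _, CutSpace.surjective_restrict _⟩,
    fun X _ => rfl, fun X Y Z _ _ => rfl, fun X Y hXY => ?_⟩
  obtain ⟨x, hxX, hxY⟩ := not_subset.1 hXY
  exact hns _ _ x (fun y h => h hxX) fun y => hxY
end
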